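/- arXiv:1312.6518 — 8 statements merged into one kernel-verified Lean document; each statement's English description precedes it below -/
import Mathlib

section
/- Let V be a 2n-dimensional real vector space (n ≥ 1) equipped with a nondegenerate symmetric bilinear form g of signature (n,n) (i.e. there is a basis of V in which g is represented by the diagonal matrix with n entries equal to 1 and n entries equal to −1), and let h : V → V be a linear map that is self-adjoint with respect to g (g(hX,Y) = g(X,hY) for all X,Y) and satisfies h ∘ h = 0. Then there exist a basis X₁, Y₁, …, Xₙ, Yₙ of V, signs ε₁, …, εₙ ∈ {1, −1}, and a natural number r equal to the rank of h, with 0 ≤ r ≤ n, such that: g(Xᵢ, Yᵢ) = εᵢ for all i, all other pairings of distinct basis vectors under g vanish and g(Xᵢ,Xᵢ) = g(Yᵢ,Yᵢ) = 0; h Xᵢ = Yᵢ for 1 ≤ i ≤ r; h Xᵢ = 0 for r < i ≤ n; and h Yᵢ = 0 for all i. In particular, if h ≠ 0 then 1 ≤ rank h ≤ n. -/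
open Module

/-- An isotropic subspace lies in a Lagrangian one, as soon as a Lagrangian exists. -/
lemma aux_exists_lagrangian {V : Type*} [AddCommGroup V] [Module ℝ V] [FiniteDimensional ℝ V]
    (n : ℕ) (g : LinearMap.BilinForm ℝ V) (hgsymm : ∀ x y : V, g x y = g y x)
    (hnd : g.Nondegenerate) (hV : finrank ℝ V = n + n)
    (L : Submodule ℝ V) (hL : ∀ x ∈ L, ∀ y ∈ L, g x y = 0) (hLn : finrank ℝ L = n)
    (Y : Submodule ℝ V) (hY : ∀ x ∈ Y, ∀ y ∈ Y, g x y = 0) :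
    ∃ M : Submodule ℝ V, Y ≤ M ∧ (∀ x ∈ M, ∀ y ∈ M, g x y = 0) ∧ finrank ℝ M = n := by
  have hLL : L = g.orthogonal L := by
    apply Submodule.eq_of_le_of_finrank_eq
    · intro x hx y hy
      exact hL y hy x hx
    · rw [LinearMap.BilinForm.finrank_orthogonal hnd, hV, hLn]; omega
  set P := g.orthogonal (Y ⊔ L) with hP
  have hPL : P ≤ L := by
    rw [hLL]; exact LinearMap.BilinForm.orthogonal_le le_sup_right
  have hPY : ∀ x ∈ P, ∀ y ∈ Y, g y x = 0 := fun x hx y hy =>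
    hx y (Submodule.mem_sup_left hy)
  have hinf : P ⊓ Y = Y ⊓ L := by
    apply le_antisymm
    · intro x hx
      exact ⟨hx.2, hPL hx.1⟩
    · rintro x ⟨hx1, hx2⟩
      refine ⟨?_, hx1⟩
      change x ∈ g.orthogonal (Y ⊔ L)
      rw [LinearMap.BilinForm.mem_orthogonal_iff]
      intro z hz
      obtain ⟨a, ha, b, hb, rfl⟩ := Submodule.mem_sup.1 hz
      simp [hY a ha x hx1, hL b hb x hx2]
  refine ⟨P ⊔ Y, le_sup_right, ?_, ?_⟩
  · intro x hx y hy
    obtain ⟨a, ha, b, hb, rfl⟩ := Submodule.mem_sup.1 hx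
    obtain ⟨c, hc, d, hd, rfl⟩ := Submodule.mem_sup.1 hy
    simp [hL a (hPL ha) c (hPL hc), hY b hb d hd, hPY c hc b hb, hgsymm a d, hPY a ha d hd]
  · have h1 := Submodule.finrank_sup_add_finrank_inf_eq P Y
    have h2 := Submodule.finrank_sup_add_finrank_inf_eq Y L
    have h3 := LinearMap.BilinForm.finrank_orthogonal hnd (Y ⊔ L)
    have h4 := Submodule.finrank_le (Y ⊔ L)
    rw [hinf] at h1
    rw [← hP] at h3
    omega

/-- Reordering of a finite family so that the members with a given property come first. -/
lemma aux_perm (n : ℕ) (p : Fin n → Prop) :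
    ∃ (r : ℕ) (σ : Equiv.Perm (Fin n)), r ≤ n ∧ ∀ i : Fin n, (i : ℕ) < r ↔ p (σ i) := by
  classical
  have hle : Fintype.card {i // p i} ≤ n := by
    simpa using Fintype.card_subtype_le p
  have hc : Fintype.card {i : Fin n // (i : ℕ) < Fintype.card {i // p i}}
      = Fintype.card {i // p i} := by
    generalize Fintype.card {i // p i} = r at hle
    have e : {i : Fin n // (i : ℕ) < r} ≃ Fin r :=
      ⟨fun i => ⟨i.1.1, i.2⟩, fun i => ⟨⟨i.1, by omega⟩, i.2⟩, fun _ => rfl, fun _ => rfl⟩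
    simpa using Fintype.card_congr e
  have e := Fintype.equivOfCardEq hc
  refine ⟨_, e.extendSubtype, hle, fun i => ⟨fun hi => e.extendSubtype_mem i hi, fun hi => ?_⟩⟩
  by_contra hcon
  exact e.extendSubtype_not_mem i hcon hi

/-- Normalisation of a real number by a square. -/
lemma aux_scale (d : ℝ) : ∃ c ε : ℝ, c ≠ 0 ∧ (ε = 1 ∨ ε = -1) ∧ (d ≠ 0 → c * c * d = ε) := by
  rcases lt_trichotomy d 0 with hd | hd | hd
  · refine ⟨(√(-d))⁻¹, -1, ?_, Or.inr rfl, fun _ => ?_⟩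
    · have := Real.sqrt_pos.2 (neg_pos.2 hd); positivity
    · rw [← mul_inv, Real.mul_self_sqrt (by linarith)]; field_simp
  · exact ⟨1, 1, one_ne_zero, Or.inl rfl, fun h => absurd hd h⟩
  · refine ⟨(√d)⁻¹, 1, ?_, Or.inl rfl, fun _ => ?_⟩
    · have := Real.sqrt_pos.2 hd; positivity
    · rw [← mul_inv, Real.mul_self_sqrt (by linarith)]; field_simp

/-- The Gram relations of a hyperbolic family force linear independence. -/
lemma aux_li {V : Type*} [AddCommGroup V] [Module ℝ V] (n : ℕ) (g : V →ₗ[ℝ] V →ₗ[ℝ] ℝ)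
    (hgsymm : ∀ x y : V, g x y = g y x) (x y : Fin n → V) (ε : Fin n → ℝ)
    (hε : ∀ i, ε i = 1 ∨ ε i = -1)
    (hxy : ∀ i j, g (x i) (y j) = if i = j then ε i else 0)
    (hxx : ∀ i j, g (x i) (x j) = 0) (hyy : ∀ i j, g (y i) (y j) = 0) :
    LinearIndependent ℝ (Sum.elim x y) := by
  have hε0 : ∀ i, ε i ≠ 0 := fun i => by rcases hε i with h | h <;> rw [h] <;> norm_num
  rw [Fintype.linearIndependent_iff]
  intro c hc
  rw [Fintype.sum_sum_type] at hc
  simp only [Sum.elim_inl, Sum.elim_inr] at hc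
  rintro (j | j)
  · have := congrArg (fun v => g v (y j)) hc
    simpa [hxy, hyy, hε0] using this
  · have := congrArg (fun v => g (x j) v) hc
    simpa [hxy, hxx, hε0] using this


/-- Pointwise classification of a self-adjoint endomorphism `h` with `h ∘ h = 0`
on a `2n`-dimensional real vector space with a symmetric bilinear form of
signature `(n,n)`: there is a basis `X₁, Y₁, …, Xₙ, Yₙ` (indexed by `Fin n ⊕ Fin n`,
with `Xᵢ = b (inl i)` and `Yᵢ = b (inr i)`) as in Theorem 3.2 of the paper. -/
theorem paracontact_h_pointwise_classification
    (V : Type*) [AddCommGroup V] [Module ℝ V]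
    (n : ℕ) (hn : 1 ≤ n)
    (g : V →ₗ[ℝ] V →ₗ[ℝ] ℝ)
    (hgsymm : ∀ x y : V, g x y = g y x)
    (hsig : ∃ e : Module.Basis (Fin n ⊕ Fin n) ℝ V, ∀ i j,
      g (e i) (e j) =
        if i = j then Sum.elim (fun _ => (1 : ℝ)) (fun _ => (-1 : ℝ)) i else 0)
    (h : V →ₗ[ℝ] V)
    (hadj : ∀ x y : V, g (h x) y = g x (h y))
    (hh2 : h ∘ₗ h = 0) :
    ∃ (b : Module.Basis (Fin n ⊕ Fin n) ℝ V) (ε : Fin n → ℝ) (r : ℕ),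
      (∀ i, ε i = 1 ∨ ε i = -1) ∧
      r = Module.finrank ℝ (LinearMap.range h) ∧
      r ≤ n ∧
      (∀ i j, g (b (Sum.inl i)) (b (Sum.inr j)) = if i = j then ε i else 0) ∧
      (∀ i j, g (b (Sum.inl i)) (b (Sum.inl j)) = 0) ∧
      (∀ i j, g (b (Sum.inr i)) (b (Sum.inr j)) = 0) ∧
      (∀ i : Fin n, (i : ℕ) < r → h (b (Sum.inl i)) = b (Sum.inr i)) ∧
      (∀ i : Fin n, r ≤ (i : ℕ) → h (b (Sum.inl i)) = 0) ∧
      (∀ i : Fin n, h (b (Sum.inr i)) = 0) ∧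
      (h ≠ 0 → 1 ≤ r) := by
  classical
  obtain ⟨e, he⟩ := hsig
  have : FiniteDimensional ℝ V := Module.Basis.finiteDimensional_of_finite e
  have hV : finrank ℝ V = n + n := by simpa using Module.finrank_eq_card_basis e
  have hh : ∀ v, h (h v) = 0 := fun v => LinearMap.congr_fun hh2 v
  have hnd : LinearMap.BilinForm.Nondegenerate g := by
    refine (LinearMap.BilinForm.iIsOrtho.nondegenerate_iff_not_isOrtho_basis_self g e ?_).2 ?_
    · intro i j hij
      simp [Function.onFun, he, hij]
    · rintro (i | i) <;> simp [he]
  -- a Lagrangian subspace from the signature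
  have hli : LinearIndependent ℝ (fun i : Fin n => e (Sum.inl i) + e (Sum.inr i)) := by
    rw [Fintype.linearIndependent_iff]
    intro c hc j
    have := congrArg (fun v => g v (e (Sum.inl j))) hc
    simpa [he] using this
  obtain ⟨M, hYM, hM, hMn⟩ := aux_exists_lagrangian n g hgsymm hnd hV
    (Submodule.span ℝ (Set.range (fun i : Fin n => e (Sum.inl i) + e (Sum.inr i))))
    (by
      intro x hx y hy
      induction hx using Submodule.span_induction with
      | mem x hx =>
        obtain ⟨i, rfl⟩ := hx
        induction hy using Submodule.span_induction with
        | mem y hy =>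
          obtain ⟨j, rfl⟩ := hy
          by_cases hij : i = j <;> simp [he, hij]
        | zero => simp
        | add a b _ _ ha hb => rw [map_add, ha, hb, add_zero]
        | smul c a _ ha => rw [map_smul, ha, smul_zero]
      | zero => simp
      | add a b _ _ ha hb => rw [map_add, LinearMap.add_apply, ha, hb, add_zero]
      | smul c a _ ha => rw [map_smul, LinearMap.smul_apply, ha, smul_zero])
    (by rw [finrank_span_eq_card hli]; simp)
    (LinearMap.range h)
    (by
      rintro _ ⟨a, rfl⟩ _ ⟨b, rfl⟩
      rw [hadj, hh, map_zero])
  have hMh : ∀ v, h v ∈ M := fun v => hYM ⟨v, rfl⟩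
  have hnd0 : ∀ v, (∀ w, g w v = 0) → v = 0 := fun v hv => hnd.2 v hv
  have hMker : ∀ y ∈ M, h y = 0 := fun y hy => hnd0 _ fun w => by
    rw [← hadj]; exact hM _ (hMh w) _ hy
  obtain ⟨C, hC⟩ := Submodule.exists_isCompl M
  have hCn : finrank ℝ C = n := by
    have := Submodule.finrank_add_eq_of_isCompl hC
    omega
  -- diagonalise `g (h x) y` on `C`
  let β : LinearMap.BilinForm ℝ C := LinearMap.BilinForm.restrict (g ∘ₗ h) C
  have hβ : ∀ a b : C, β a b = g (h a) b := fun a b => rfl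
  have hβs : LinearMap.IsSymm β := ⟨fun a b => by
    simp only [RingHom.id_apply, hβ]; rw [hadj, hgsymm]⟩
  obtain ⟨v0, hv0⟩ := LinearMap.BilinForm.exists_orthogonal_basis hβs
  let v1 : Basis (Fin n) ℝ C := v0.reindex (finCongr hCn)
  have hv1 : ∀ i j, i ≠ j → g (h (v1 i)) (v1 j) = 0 := by
    intro i j hij
    rw [← hβ]
    simp only [v1, Basis.reindex_apply]
    exact hv0 (by simpa using hij)
  obtain ⟨r, σ, hrn, hσ⟩ := aux_perm n (fun i => g (h (v1 i)) (v1 i) ≠ 0)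
  let v : Basis (Fin n) ℝ C := v1.reindex σ.symm
  have hvv : ∀ i, v i = v1 (σ i) := fun i => by simp [v]
  have hv : ∀ i j, i ≠ j → g (h (v i)) (v j) = 0 := by
    intro i j hij
    rw [hvv, hvv]; exact hv1 _ _ (by simpa using hij)
  have hvr : ∀ i : Fin n, (i : ℕ) < r ↔ g (h (v i)) (v i) ≠ 0 := fun i => by rw [hvv]; exact hσ i
  choose c ε hc0 hε hcε using fun i => aux_scale (g (h (v i)) (v i))
  have hεε : ∀ i, ε i * ε i = 1 := fun i => by rcases hε i with h | h <;> rw [h] <;> norm_num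
  -- the pairing of `C` and `M`
  let T : M →ₗ[ℝ] (Fin n → ℝ) := LinearMap.pi fun i => (g (c i • (v i : V))) ∘ₗ M.subtype
  have hT : ∀ (y : M) i, T y i = g (c i • (v i : V)) y := fun y i => rfl
  have hTinj : Function.Injective T := by
    rw [injective_iff_map_eq_zero]
    intro y hy
    have h1 : ∀ i, g (v i) y = 0 := by
      intro i
      have := congrFun hy i
      rw [hT] at this
      simpa [hc0 i] using this
    have h2 : ∀ x : C, g x y = 0 := by
      intro x
      have hx : (x : V) = ∑ i, v.repr x i • (v i : V) := by
        conv_lhs => rw [← v.sum_repr x]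
        simp only [Submodule.coe_sum, Submodule.coe_smul]
      rw [hx]
      simp only [map_sum, map_smul, LinearMap.sum_apply, LinearMap.smul_apply, h1, smul_zero,
        Finset.sum_const_zero]
    apply Subtype.ext
    apply hnd0
    intro w
    have hw : w ∈ M ⊔ C := by rw [hC.sup_eq_top]; trivial
    obtain ⟨a, ha, b, hb, rfl⟩ := Submodule.mem_sup.1 hw
    rw [map_add, LinearMap.add_apply, hM a ha y y.2, h2 ⟨b, hb⟩, add_zero]
  have hTsurj : Function.Surjective T :=
    (LinearMap.injective_iff_surjective_of_finrank_eq_finrank (by simp [hMn])).1 hTinj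
  choose y hy using fun j => hTsurj (fun i => if i = j then ε i else 0)
  let x0 : Fin n → V := fun i => c i • (v i : V)
  have hx0y : ∀ i j, g (x0 i) (y j) = if i = j then ε i else 0 := fun i j => by
    have := congrFun (hy j) i
    rwa [hT] at this
  have hhx1 : ∀ i : Fin n, (i : ℕ) < r → h (x0 i) = y i := by
    intro i hi
    have : (⟨h (x0 i), hMh _⟩ : M) = y i := by
      apply hTinj
      rw [hy]
      funext j
      rw [hT]
      by_cases hij : j = i
      · subst hij
        simp only [if_true, x0]
        rw [← hcε j ((hvr j).1 hi), ← hadj]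
        simp [mul_assoc]
      · rw [if_neg hij, ← hadj]
        simp [x0, hv j i hij]
    exact congrArg Subtype.val this
  have hhx2 : ∀ i : Fin n, r ≤ (i : ℕ) → h (x0 i) = 0 := by
    intro i hi
    have : (⟨h (x0 i), hMh _⟩ : M) = 0 := by
      apply hTinj
      rw [map_zero]
      funext j
      rw [hT, ← hadj]
      by_cases hij : j = i
      · subst hij
        have : g (h (v j)) (v j) = 0 := by
          by_contra hcon
          have := (hvr j).2 hcon
          omega
        simp [x0, this]
      · simp [x0, hv j i hij]
    exact congrArg Subtype.val this
  -- correct the `X` part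
  let z : Fin n → V := fun i => ∑ k, ((1 / 2 : ℝ) * g (x0 i) (x0 k) * ε k) • (y k : V)
  have hzM : ∀ i, z i ∈ M := fun i =>
    Submodule.sum_mem _ fun k _ => Submodule.smul_mem _ _ (y k).2
  have hxz : ∀ i j, g (x0 i) (z j) = 1 / 2 * g (x0 i) (x0 j) := by
    intro i j
    simp only [z, map_sum, map_smul, hx0y, smul_eq_mul]
    simp only [mul_ite, mul_zero, Finset.sum_ite_eq, Finset.mem_univ, if_true]
    rw [mul_assoc, hεε, mul_one, hgsymm]
  let x : Fin n → V := fun i => x0 i - z i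
  have hxx : ∀ i j, g (x i) (x j) = 0 := by
    intro i j
    simp only [x, map_sub, LinearMap.sub_apply, hxz, hM _ (hzM i) _ (hzM j)]
    rw [hgsymm (z i), hxz, hgsymm (x0 j)]
    ring
  have hxy : ∀ i j, g (x i) (y j) = if i = j then ε i else 0 := by
    intro i j
    simp only [x, map_sub, LinearMap.sub_apply, hx0y, hM _ (hzM i) _ (y j).2, sub_zero]
  have hyy : ∀ i j, g (y i : V) (y j) = 0 := fun i j => hM _ (y i).2 _ (y j).2
  have hhx : ∀ i, h (x i) = h (x0 i) := fun i => by
    simp only [x, map_sub, hMker _ (hzM i), sub_zero]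
  have hLI := aux_li n g hgsymm x (fun i => (y i : V)) ε hε hxy hxx hyy
  have : Nonempty (Fin n ⊕ Fin n) := ⟨Sum.inl ⟨0, hn⟩⟩
  have hcard : Fintype.card (Fin n ⊕ Fin n) = finrank ℝ V := by simp [hV]
  let b := basisOfLinearIndependentOfCardEqFinrank hLI hcard
  have hb : ⇑b = Sum.elim x (fun i => (y i : V)) :=
    coe_basisOfLinearIndependentOfCardEqFinrank hLI hcard
  have hbl : ∀ i, b (Sum.inl i) = x i := fun i => by rw [hb]; rfl
  have hbr : ∀ i, b (Sum.inr i) = y i := fun i => by rw [hb]; rfl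
  have hyli : LinearIndependent ℝ (fun i : Fin r => (y (Fin.castLE hrn i) : V)) := by
    have := hLI.comp (fun i : Fin r => Sum.inr (Fin.castLE hrn i))
      (fun i j hij => by simpa using hij)
    exact this
  have hrange : LinearMap.range h
      = Submodule.span ℝ (Set.range (fun i : Fin r => (y (Fin.castLE hrn i) : V))) := by
    apply le_antisymm
    · rw [LinearMap.range_eq_map, ← b.span_eq, Submodule.map_span, Submodule.span_le]
      rintro _ ⟨_, ⟨i, rfl⟩, rfl⟩
      rcases i with i | i
      · rw [hbl, hhx]
        by_cases hi : (i : ℕ) < r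
        · rw [hhx1 i hi]
          exact Submodule.subset_span ⟨⟨i, hi⟩, rfl⟩
        · rw [hhx2 i (not_lt.1 hi)]
          exact Submodule.zero_mem _
      · rw [hbr, hMker _ (y i).2]
        exact Submodule.zero_mem _
    · rw [Submodule.span_le]
      rintro _ ⟨i, rfl⟩
      exact ⟨x0 (Fin.castLE hrn i), hhx1 _ i.2⟩
  have hr : r = finrank ℝ (LinearMap.range h) := by
    rw [hrange, finrank_span_eq_card hyli, Fintype.card_fin]
  refine ⟨b, ε, r, hε, hr, hrn, ?_, ?_, ?_, ?_, ?_, ?_, ?_⟩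
  · intro i j; rw [hbl, hbr, hxy]
  · intro i j; rw [hbl, hbl, hxx]
  · intro i j; rw [hbr, hbr, hyy]
  · intro i hi; rw [hbl, hbr, hhx, hhx1 i hi]
  · intro i hi; rw [hbl, hhx, hhx2 i hi]
  · intro i; rw [hbr, hMker _ (y i).2]
  · intro h0
    by_contra hcon
    apply h0
    have : finrank ℝ (LinearMap.range h) = 0 := by omega
    rw [Submodule.finrank_eq_zero] at this
    exact LinearMap.range_eq_bot.1 this
end

section
/- Let V be a 3-dimensional real vector space with a nondegenerate symmetric bilinear form g, let ξ ∈ V satisfy g(ξ,ξ) = 1 and set η(X) = g(X,ξ). Let φ : V → V be a linear map with φξ = 0, φ(φX) = X − η(X)ξ for all X, g(φX, φY) = −g(X,Y) + η(X)η(Y) for all X,Y, and g(φX, Y) = −g(X, φY) for all X,Y. Let h : V → V be linear, self-adjoint with respect to g (g(hX,Y) = g(X,hY)), and anti-commute with φ (h ∘ φ = −φ ∘ h). Suppose {ξ, X₁, Y₁} is a basis of V such that g(ξ,X₁) = g(ξ,Y₁) = g(X₁,X₁) = g(Y₁,Y₁) = 0 and g(X₁,Y₁) = ε with ε ∈ {1,−1},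 and suppose h X₁ = Y₁, h Y₁ = 0 and h ξ = 0. Then there exists a ∈ {1,−1} such that φX₁ = a X₁ and φY₁ = −a Y₁. -/
/-- Pointwise 3-dimensional refinement: on a 3-dimensional almost paracontact
metric "vector space" with `h X₁ = Y₁`, `h Y₁ = 0`, `h ξ = 0`, the tensor `φ`
satisfies `φ X₁ = ± X₁` and `φ Y₁ = ∓ Y₁`. -/
theorem phi_diagonal_dim3
    (V : Type*) [AddCommGroup V] [Module ℝ V]
    (g : V →ₗ[ℝ] V →ₗ[ℝ] ℝ)
    (hgsymm : ∀ x y : V, g x y = g y x)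
    (hgnd : ∀ x : V, (∀ y : V, g x y = 0) → x = 0)
    (ξ : V) (hξ : g ξ ξ = 1)
    (η : V → ℝ) (hη : ∀ x, η x = g x ξ)
    (φ : V →ₗ[ℝ] V)
    (hφξ : φ ξ = 0)
    (hφ2 : ∀ x, φ (φ x) = x - η x • ξ)
    (hgφφ : ∀ x y, g (φ x) (φ y) = -g x y + η x * η y)
    (hganti : ∀ x y, g (φ x) y = -g x (φ y))
    (h : V →ₗ[ℝ] V)
    (hadj : ∀ x y, g (h x) y = g x (h y))
    (hhφ : ∀ x, h (φ x) = -φ (h x))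
    (X1 Y1 : V)
    (b : Module.Basis (Fin 3) ℝ V) (hb : ∀ i, b i = ![ξ, X1, Y1] i)
    (ε : ℝ) (hε : ε = 1 ∨ ε = -1)
    (hgξX1 : g ξ X1 = 0) (hgξY1 : g ξ Y1 = 0)
    (hgX1X1 : g X1 X1 = 0) (hgY1Y1 : g Y1 Y1 = 0)
    (hgX1Y1 : g X1 Y1 = ε)
    (hhX1 : h X1 = Y1) (hhY1 : h Y1 = 0) (hhξ : h ξ = 0) :
    ∃ a : ℝ, (a = 1 ∨ a = -1) ∧ φ X1 = a • X1 ∧ φ Y1 = -(a • Y1) := by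
  have hrep := b.sum_repr (φ X1)
  simp only [Fin.sum_univ_three, hb, Matrix.cons_val_zero, Matrix.cons_val_one,
    Matrix.cons_val] at hrep
  generalize b.repr (φ X1) 0 = c at hrep
  generalize b.repr (φ X1) 1 = a at hrep
  generalize b.repr (φ X1) 2 = d at hrep
  have hε0 : ε ≠ 0 := by rcases hε with h1 | h1 <;> rw [h1] <;> norm_num
  have e1 : g (φ X1) ξ = 0 := by rw [hganti, hφξ]; simp
  have e2 : g (φ X1) X1 = 0 := by
    have h1 := hganti X1 X1
    rw [hgsymm X1 (φ X1)] at h1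
    linarith
  have hXξ : g X1 ξ = 0 := by rw [hgsymm, hgξX1]
  have hYξ : g Y1 ξ = 0 := by rw [hgsymm, hgξY1]
  have hYX : g Y1 X1 = ε := by rw [hgsymm, hgX1Y1]
  rw [← hrep] at e1 e2
  simp only [map_add, map_smul, LinearMap.add_apply, LinearMap.smul_apply, smul_eq_mul,
    hξ, hXξ, hYξ, hYX, hgξX1, hgX1X1, mul_zero, mul_one, add_zero, zero_add] at e1 e2
  have hd : d = 0 := by
    rcases mul_eq_zero.mp e2 with h1 | h1
    · exact h1
    · exact absurd h1 hε0
  have hX : φ X1 = a • X1 := by rw [← hrep, e1, hd]; simp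
  have hX0 : X1 ≠ 0 := by
    intro h0
    rw [h0] at hgX1Y1
    simp at hgX1Y1
    exact hε0 hgX1Y1.symm
  have ha : a * a = 1 := by
    have h1 := hφ2 X1
    rw [hη, hXξ, hX, map_smul, hX, smul_smul, zero_smul, sub_zero] at h1
    have h2 : (a * a - 1) • X1 = 0 := by rw [sub_smul, h1, one_smul, sub_self]
    rcases smul_eq_zero.mp h2 with h3 | h3
    · linarith
    · exact absurd h3 hX0
  refine ⟨a, mul_self_eq_one_iff.mp ha, hX, ?_⟩
  have h1 := hhφ X1
  rw [hX, map_smul, hhX1] at h1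
  rw [h1, neg_neg]
end

section
/- Let 𝔤 be a 5-dimensional real Lie algebra with basis {ξ, X₁, Y₁, X₂, Y₂} whose only non-vanishing Lie brackets among basis vectors are [X₁,Y₁] = 2ξ, [X₂,Y₂] = 2ξ, and [X₁,X₂] = Y₁. Let g be the symmetric bilinear form whose only non-vanishing values on basis vectors are g(ξ,ξ) = g(X₁,Y₁) = g(X₂,Y₂) = 1, set η(X) = g(X,ξ), and let ∇ be the Levi-Civita product of (𝔤,g) with curvature R. Then R(Z,ξ)ξ = −(Z − η(Z)ξ) for all Z ∈ 𝔤, but R(X₁,X₂)ξ = −2Y₁ ≠ 0; in particular R(X,Y)ξ = −(η(Y)X − η(X)Y) fails for X = X₁, Y = X₂. -/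
/-- Example 2.1 of the paper (curvature computation): for the 5-dimensional Lie
algebra with `[X₁,Y₁] = [X₂,Y₂] = 2ξ`, `[X₁,X₂] = Y₁` and the given metric,
`R(Z,ξ)ξ = -(Z - η(Z)ξ)` for all `Z`, but `R(X₁,X₂)ξ = -2Y₁ ≠ 0`, so
`R(x,y)ξ = -(η(y)x - η(x)y)` fails. -/
theorem Kparacontact_not_paraSasakian_example
    (𝔤 : Type*) [LieRing 𝔤] [LieAlgebra ℝ 𝔤]
    (ξ X1 Y1 X2 Y2 : 𝔤)
    (b : Module.Basis (Fin 5) ℝ 𝔤) (hb : ∀ i, b i = ![ξ, X1, Y1, X2, Y2] i)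
    -- the only non-vanishing Lie brackets among basis vectors:
    (br1 : ⁅ξ, X1⁆ = 0) (br2 : ⁅ξ, Y1⁆ = 0) (br3 : ⁅ξ, X2⁆ = 0) (br4 : ⁅ξ, Y2⁆ = 0)
    (br5 : ⁅X1, Y1⁆ = (2 : ℝ) • ξ)
    (br6 : ⁅X1, X2⁆ = Y1) (br7 : ⁅X1, Y2⁆ = 0)
    (br8 : ⁅Y1, X2⁆ = 0) (br9 : ⁅Y1, Y2⁆ = 0)
    (br10 : ⁅X2, Y2⁆ = (2 : ℝ) • ξ)
    -- the symmetric bilinear form: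
    (g : 𝔤 →ₗ[ℝ] 𝔤 →ₗ[ℝ] ℝ) (hgsymm : ∀ x y : 𝔤, g x y = g y x)
    (hg1 : g ξ ξ = 1) (hg2 : g ξ X1 = 0) (hg3 : g ξ Y1 = 0) (hg4 : g ξ X2 = 0)
    (hg5 : g ξ Y2 = 0) (hg6 : g X1 X1 = 0) (hg7 : g X1 Y1 = 1) (hg8 : g X1 X2 = 0)
    (hg9 : g X1 Y2 = 0) (hg10 : g Y1 Y1 = 0) (hg11 : g Y1 X2 = 0) (hg12 : g Y1 Y2 = 0)
    (hg13 : g X2 X2 = 0) (hg14 : g X2 Y2 = 1) (hg15 : g Y2 Y2 = 0)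
    (η : 𝔤 → ℝ) (hη : ∀ x, η x = g x ξ)
    -- Levi-Civita product and curvature:
    (nabla : 𝔤 →ₗ[ℝ] 𝔤 →ₗ[ℝ] 𝔤)
    (hkoszul : ∀ x y z : 𝔤,
      2 * g (nabla x y) z = g ⁅x, y⁆ z - g ⁅y, z⁆ x + g ⁅z, x⁆ y)
    (R : 𝔤 → 𝔤 → 𝔤 → 𝔤)
    (hR : ∀ x y z : 𝔤,
      R x y z = nabla x (nabla y z) - nabla y (nabla x z) - nabla ⁅x, y⁆ z) :
    (∀ z : 𝔤, R z ξ ξ = -(z - η z • ξ)) ∧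
    R X1 X2 ξ = -((2 : ℝ) • Y1) ∧
    -((2 : ℝ) • Y1) ≠ 0 ∧
    R X1 X2 ξ ≠ -(η X2 • X1 - η X1 • X2) := by
  have e0 : b 0 = ξ := hb 0
  have e1 : b 1 = X1 := hb 1
  have e2 : b 2 = Y1 := hb 2
  have e3 : b 3 = X2 := hb 3
  have e4 : b 4 = Y2 := hb 4
  have expand : ∀ v : 𝔤, ∃ c0 c1 c2 c3 c4 : ℝ,
      v = c0 • ξ + c1 • X1 + c2 • Y1 + c3 • X2 + c4 • Y2 := by
    intro v
    refine ⟨b.repr v 0, b.repr v 1, b.repr v 2, b.repr v 3, b.repr v 4, ?_⟩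
    have h := b.sum_repr v
    rw [Fin.sum_univ_five, e0, e1, e2, e3, e4] at h
    exact h.symm
  -- the form is nondegenerate
  have nondeg : ∀ v : 𝔤, g v ξ = 0 → g v X1 = 0 → g v Y1 = 0 → g v X2 = 0 → g v Y2 = 0 →
      v = 0 := by
    intro v h0 h1 h2 h3 h4
    obtain ⟨c0, c1, c2, c3, c4, rfl⟩ := expand v
    simp only [map_add, map_smul, LinearMap.add_apply, LinearMap.smul_apply, smul_eq_mul,
      hgsymm X1 ξ, hgsymm Y1 ξ, hgsymm X2 ξ, hgsymm Y2 ξ, hgsymm Y1 X1, hgsymm X2 X1,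
      hgsymm Y2 X1, hgsymm X2 Y1, hgsymm Y2 Y1, hgsymm Y2 X2,
      hg1, hg2, hg3, hg4, hg5, hg6, hg7, hg8, hg9, hg10, hg11, hg12, hg13, hg14, hg15,
      mul_zero, mul_one, add_zero, zero_add] at h0 h1 h2 h3 h4
    simp [h0, h1, h2, h3, h4]
  have ext_g : ∀ u v : 𝔤, (∀ z, g u z = g v z) → u = v := by
    intro u v h
    have h' : ∀ z, g (u - v) z = 0 := fun z => by simp [h z]
    exact sub_eq_zero.mp (nondeg _ (h' _) (h' _) (h' _) (h' _) (h' _))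
  have torsion : ∀ x y : 𝔤, nabla x y - nabla y x = ⁅x, y⁆ := by
    intro x y
    apply ext_g
    intro z
    have h1 := hkoszul x y z
    have h2 := hkoszul y x z
    rw [← lie_skew z x, ← lie_skew z y, ← lie_skew y x] at *
    simp only [map_neg, map_sub, LinearMap.neg_apply, LinearMap.sub_apply] at *
    linarith
  have sk : ∀ x y w : 𝔤, ⁅x, y⁆ = w → ⁅y, x⁆ = -w := by
    intro x y w h
    rw [← h, lie_skew]
  have cent : ∀ x : 𝔤, ⁅ξ, x⁆ = 0 := by
    intro x
    obtain ⟨c0, c1, c2, c3, c4, rfl⟩ := expand x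
    simp [br1, br2, br3, br4]
  have cent' : ∀ x : 𝔤, ⁅x, ξ⁆ = 0 := fun x => by simpa using sk _ _ _ (cent x)
  have comm : ∀ x : 𝔤, nabla ξ x = nabla x ξ := fun x => by
    have h := torsion ξ x
    rw [cent] at h
    exact sub_eq_zero.mp h
  have kz : ∀ x z : 𝔤, 2 * g (nabla x ξ) z = g ⁅z, x⁆ ξ := by
    intro x z
    rw [hkoszul, cent, cent']
    simp
  have key : ∀ x v : 𝔤, (∀ z, 2 * g v z = g ⁅z, x⁆ ξ) → nabla x ξ = v := by
    intro x v h
    apply ext_g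
    intro z
    have h1 := kz x z
    have h2 := h z
    linarith
  have n0 : nabla ξ ξ = 0 := by
    apply key
    intro z
    simp [cent']
  have n1 : nabla X1 ξ = -X1 := by
    apply key
    intro z
    obtain ⟨c0, c1, c2, c3, c4, rfl⟩ := expand z
    simp [cent, sk _ _ _ br5, sk _ _ _ br6, sk _ _ _ br7, hgsymm Y1 ξ,
      hgsymm X1 ξ, hg1, hg2, hg3, hg6, hg7, hg8, hg9] <;> ring
  have n2 : nabla Y1 ξ = Y1 := by
    apply key
    intro z
    obtain ⟨c0, c1, c2, c3, c4, rfl⟩ := expand z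
    simp [cent, sk _ _ _ br8, sk _ _ _ br9, br5, hgsymm Y1 ξ, hgsymm Y1 X1, hg1, hg3, hg7, hg10,
      hg11, hg12] <;> ring
  have n3 : nabla X2 ξ = -X2 := by
    apply key
    intro z
    obtain ⟨c0, c1, c2, c3, c4, rfl⟩ := expand z
    simp [cent, sk _ _ _ br10, br6, br8, hgsymm X2 ξ, hgsymm X2 X1, hgsymm X2 Y1, hgsymm Y1 ξ,
      hg1, hg3, hg4, hg8, hg11, hg13, hg14] <;> ring
  have n4 : nabla Y2 ξ = Y2 := by
    apply key
    intro z
    obtain ⟨c0, c1, c2, c3, c4, rfl⟩ := expand z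
    simp [cent, br7, br9, br10, hgsymm Y2 ξ, hgsymm Y2 X1, hgsymm Y2 Y1, hgsymm Y2 X2,
      hg1, hg5, hg9, hg12, hg14, hg15] <;> ring
  have hR12 : R X1 X2 ξ = -((2 : ℝ) • Y1) := by
    have h := torsion X1 X2
    rw [br6] at h
    rw [hR, br6, n1, n2, n3, map_neg, map_neg, sub_eq_iff_eq_add.mp h]
    module
  have hne : -((2 : ℝ) • Y1) ≠ 0 := by
    intro h
    have h' : g X1 (-((2 : ℝ) • Y1)) = 0 := by rw [h, map_zero]
    simp [hg7] at h'
  refine ⟨?_, hR12, hne, ?_⟩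
  · intro z
    rw [hR, n0, cent', hη, comm]
    obtain ⟨c0, c1, c2, c3, c4, rfl⟩ := expand z
    simp only [map_add, map_smul, LinearMap.add_apply, LinearMap.smul_apply, smul_eq_mul,
      hgsymm X1 ξ, hgsymm Y1 ξ, hgsymm X2 ξ, hgsymm Y2 ξ, hg1, hg2, hg3, hg4, hg5,
      n0, n1, n2, n3, n4, map_neg, map_zero, LinearMap.neg_apply, LinearMap.zero_apply]
    module
  · rw [hR12, hη, hη, hgsymm X2, hgsymm X1, hg2, hg4]
    simpa using hne
end

section
/- Let n ≥ 1 and let 𝔤 be the (2n+1)-dimensional real Lie algebra (Heisenberg algebra) with basis {ξ, X₁, …, X_{2n}} whose only non-vanishing Lie brackets among basis vectors are [X_{2i−1}, X_{2i}] = 2ξ for i = 1, …, n. Let g be the symmetric bilinear form whose only non-vanishing values on basis vectors are g(ξ,ξ) = 1, g(X_{2i},X_{2i}) = 1 and g(X_{2i−1},X_{2i−1}) = −1 for i = 1,…,n, set η(X) = g(X,ξ), and let ∇ be the Levi-Civita product of (𝔤,g) with curvature R. Then R(X,Y)ξ = −(η(Y)X − η(X)Y) for all X,Y ∈ 𝔤.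 -/
set_option linter.all false
set_option linter.unusedSimpArgs false
set_option maxHeartbeats 4000000

/-- The canonical paracontact metric structure on the `(2n+1)`-dimensional
Heisenberg algebra satisfies `R(x,y)ξ = -(η(y)x - η(x)y)`. Here `A i` plays the
role of `X_{2i-1}` and `B i` that of `X_{2i}`. -/
theorem heisenberg_curvature
    (𝔤 : Type*) [LieRing 𝔤] [LieAlgebra ℝ 𝔤]
    (n : ℕ) (hn : 1 ≤ n)
    (ξ : 𝔤) (A B : Fin n → 𝔤)
    (b : Module.Basis (Unit ⊕ Fin n ⊕ Fin n) ℝ 𝔤)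
    (hbξ : b (Sum.inl ()) = ξ)
    (hbA : ∀ i, b (Sum.inr (Sum.inl i)) = A i)
    (hbB : ∀ i, b (Sum.inr (Sum.inr i)) = B i)
    -- the only non-vanishing Lie brackets among basis vectors are
    -- `[X_{2i-1}, X_{2i}] = 2ξ`:
    (br1 : ∀ i, ⁅ξ, A i⁆ = 0)
    (br2 : ∀ i, ⁅ξ, B i⁆ = 0)
    (br3 : ∀ i j, ⁅A i, A j⁆ = 0)
    (br4 : ∀ i j, ⁅B i, B j⁆ = 0)
    (br5 : ∀ i j, ⁅A i, B j⁆ = if i = j then (2 : ℝ) • ξ else 0)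
    -- the symmetric bilinear form:
    (g : 𝔤 →ₗ[ℝ] 𝔤 →ₗ[ℝ] ℝ) (hgsymm : ∀ x y : 𝔤, g x y = g y x)
    (hg1 : g ξ ξ = 1)
    (hg2 : ∀ i, g ξ (A i) = 0)
    (hg3 : ∀ i, g ξ (B i) = 0)
    (hg4 : ∀ i j, g (A i) (A j) = if i = j then -1 else 0)
    (hg5 : ∀ i j, g (B i) (B j) = if i = j then 1 else 0)
    (hg6 : ∀ i j, g (A i) (B j) = 0)
    (η : 𝔤 → ℝ) (hη : ∀ x, η x = g x ξ)
    -- Levi-Civita product and curvature: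
    (nabla : 𝔤 →ₗ[ℝ] 𝔤 →ₗ[ℝ] 𝔤)
    (hkoszul : ∀ x y z : 𝔤,
      2 * g (nabla x y) z = g ⁅x, y⁆ z - g ⁅y, z⁆ x + g ⁅z, x⁆ y)
    (R : 𝔤 → 𝔤 → 𝔤 → 𝔤)
    (hR : ∀ x y z : 𝔤,
      R x y z = nabla x (nabla y z) - nabla y (nabla x z) - nabla ⁅x, y⁆ z) :
    ∀ x y : 𝔤, R x y ξ = -(η y • x - η x • y) := by
  have c1 : ∀ i, ⁅A i, ξ⁆ = 0 := fun i => by rw [← lie_skew, br1, neg_zero]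
  have c2 : ∀ i, ⁅B i, ξ⁆ = 0 := fun i => by rw [← lie_skew, br2, neg_zero]
  have c5 : ∀ i j, ⁅B i, A j⁆ = if j = i then -((2 : ℝ) • ξ) else 0 := fun i j => by
    rw [← lie_skew, br5]; split_ifs <;> simp
  have h2 : ∀ i, g (A i) ξ = 0 := fun i => by rw [hgsymm, hg2]
  have h3 : ∀ i, g (B i) ξ = 0 := fun i => by rw [hgsymm, hg3]
  have h6 : ∀ i j, g (B i) (A j) = 0 := fun i j => by rw [hgsymm, hg6]
  -- nondegeneracy
  have hz : ∀ u : 𝔤, g u ξ = 0 → (∀ i, g u (A i) = 0) → (∀ i, g u (B i) = 0) → u = 0 := by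
    intro u u1 u2 u3
    have hu := b.sum_repr u
    simp only [Fintype.sum_sum_type, hbξ, hbA, hbB, Finset.univ_unique, Finset.sum_singleton] at hu
    have hc : ∀ k, b.repr u k = 0 := by
      rintro (k | k | k)
      · rw [← hu] at u1
        simpa [h2, h3, hg1] using u1
      · have := u2 k
        rw [← hu] at this
        simpa [h6, hg2, hg4] using this
      · have := u3 k
        rw [← hu] at this
        simpa [hg6, hg3, hg5] using this
    apply b.repr.map_eq_zero_iff.mp
    ext k
    exact hc k
  have key : ∀ x y w : 𝔤,
      (∀ k, g ⁅x, y⁆ (b k) - g ⁅y, b k⁆ x + g ⁅b k, x⁆ y = 2 * g w (b k)) → nabla x y = w := by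
    intro x y w h
    have h' : ∀ k, g (nabla x y - w) (b k) = 0 := by
      intro k
      have h1 := hkoszul x y (b k)
      have h2 := h k
      rw [map_sub, LinearMap.sub_apply]
      linarith
    refine sub_eq_zero.mp (hz _ ?_ ?_ ?_)
    · rw [← hbξ]; exact h' _
    · intro i; rw [← hbA]; exact h' _
    · intro i; rw [← hbB]; exact h' _
  have nξξ : nabla ξ ξ = 0 := by
    apply key
    rintro (k | k | k) <;> simp [hbξ, hbA, hbB, br1, br2, c1, c2]
  have nAξ : ∀ i, nabla (A i) ξ = - B i := by
    intro i
    apply key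
    rintro (k | k | k) <;> simp [hbξ, hbA, hbB, br1, br2, br3, br4, br5, c1, c2, c5, hg1, hg2, hg3, hg4, hg5, hg6, h2, h3, h6]
    all_goals (clear * - hg1 hg2 hg3; split_ifs <;> simp_all)
  have nBξ : ∀ i, nabla (B i) ξ = - A i := by
    intro i
    apply key
    rintro (k | k | k) <;> simp [hbξ, hbA, hbB, br1, br2, br3, br4, br5, c1, c2, c5, hg1, hg2, hg3, hg4, hg5, hg6, h2, h3, h6]
    all_goals (clear * - hg1 hg2 hg3; split_ifs <;> simp_all)
  have nξA : ∀ i, nabla ξ (A i) = - B i := by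
    intro i
    apply key
    rintro (k | k | k) <;> simp [hbξ, hbA, hbB, br1, br2, br3, br4, br5, c1, c2, c5, hg1, hg2, hg3, hg4, hg5, hg6, h2, h3, h6]
    all_goals (clear * - hg1 hg2 hg3; split_ifs <;> simp_all)
  have nξB : ∀ i, nabla ξ (B i) = - A i := by
    intro i
    apply key
    rintro (k | k | k) <;> simp [hbξ, hbA, hbB, br1, br2, br3, br4, br5, c1, c2, c5, hg1, hg2, hg3, hg4, hg5, hg6, h2, h3, h6]
    all_goals (clear * - hg1 hg2 hg3; split_ifs <;> simp_all)
  have nAA : ∀ i j, nabla (A i) (A j) = 0 := by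
    intro i j
    apply key
    rintro (k | k | k) <;> simp [hbξ, hbA, hbB, br1, br2, br3, br4, br5, c1, c2, c5, hg1, hg2, hg3, hg4, hg5, hg6, h2, h3, h6]
    all_goals (clear * - hg1 hg2 hg3; split_ifs <;> simp_all)
  have nBB : ∀ i j, nabla (B i) (B j) = 0 := by
    intro i j
    apply key
    rintro (k | k | k) <;> simp [hbξ, hbA, hbB, br1, br2, br3, br4, br5, c1, c2, c5, hg1, hg2, hg3, hg4, hg5, hg6, h2, h3, h6]
    all_goals (clear * - hg1 hg2 hg3; split_ifs <;> simp_all)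
  have nAB : ∀ i j, nabla (A i) (B j) = if i = j then ξ else 0 := by
    intro i j
    apply key
    rintro (k | k | k) <;> by_cases hij : i = j <;> simp [hij, hbξ, hbA, hbB, br1, br2, br3, br4, br5, c1, c2, c5, hg1, hg2, hg3, hg4, hg5, hg6, h2, h3, h6]
    all_goals (clear * - hg1 hg2 hg3 hij; split_ifs <;> simp_all)
  have nBA : ∀ i j, nabla (B i) (A j) = if i = j then -ξ else 0 := by
    intro i j
    apply key
    rintro (k | k | k) <;> by_cases hij : j = i <;> simp [hij, hbξ, hbA, hbB, br1, br2, br3, br4, br5, c1, c2, c5, hg1, hg2, hg3, hg4, hg5, hg6, h2, h3, h6]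
    all_goals (clear * - hg1 hg2 hg3 hij; split_ifs <;> simp_all)
  let F : 𝔤 →ₗ[ℝ] 𝔤 →ₗ[ℝ] 𝔤 := LinearMap.mk₂ ℝ
    (fun x y => nabla x (nabla y ξ) - nabla y (nabla x ξ) - nabla ⁅x, y⁆ ξ
      + (g y ξ • x - g x ξ • y))
    (by intros; simp [add_smul]; abel)
    (by intros; simp [smul_sub, smul_smul, mul_comm])
    (by intros; simp [add_smul]; abel)
    (by intros; simp [smul_sub, smul_smul, mul_comm])
  have hF : F = 0 := by
    refine LinearMap.ext_basis b b ?_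
    rintro (k | k | k) (l | l | l) <;>
      simp [F, hbξ, hbA, hbB, br1, br2, br3, br4, br5, c1, c2, c5, hg1, h2, h3,
        nξξ, nAξ, nBξ, nξA, nξB, nAA, nBB, nAB, nBA]
    all_goals (clear * - hg1 nξξ; split_ifs <;> simp_all)
  intro x y
  have h := LinearMap.congr_fun₂ hF x y
  rw [hR, hη, hη]
  exact eq_neg_of_add_eq_zero_left h
end

section
/- Let n ≥ 1, 1 ≤ m ≤ n, and let 𝔤 be the (2n+1)-dimensional real Lie algebra with basis {ξ, X₁, Y₁, …, Xₙ, Yₙ} whose only non-vanishing Lie brackets among basis vectors are: [ξ, Xᵢ] = Yᵢ for i = 1,…,m; [Xᵢ, Yⱼ] = δᵢⱼ(2ξ + √2(1+δᵢₘ)Yₘ) + (1−δᵢⱼ)√2(δᵢₘYⱼ + δⱼₘYᵢ) for i,j = 1,…,m; [Xᵢ, Yⱼ] = δᵢⱼ(2ξ + √2Yᵢ) for i,j = m+1,…,n; and [Xᵢ, Yⱼ] = √2 Yᵢ for i = 1,…,m and j = m+1,…,n. Let φ : 𝔤 → 𝔤 be the linear map with φξ = 0, φXᵢ = Xᵢ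 and φYᵢ = −Yᵢ for all i, and define h : 𝔤 → 𝔤 by hX = ½([ξ, φX] − φ[ξ, X]). Then h Xᵢ = Yᵢ for i = 1,…,m, h Xᵢ = 0 for i = m+1,…,n, h Yᵢ = 0 for all i = 1,…,n, and h ξ = 0; consequently h ∘ h = 0, h ≠ 0 and the rank of h equals m. -/
/-- Computation of the tensor `h = ½ L_ξ φ` for the paper's
`(2n+1)`-dimensional paracontact metric `(-1,2)`-space with `rank h = m`
(Example 4.2). Indices are 0-based: `i.val < m` means `i ∈ {1,…,m}` and `m'`
is the index of `Xₘ, Yₘ`. -/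
theorem h_tensor_example_mu2_rank_m
    (𝔤 : Type*) [LieRing 𝔤] [LieAlgebra ℝ 𝔤]
    (n m : ℕ) (hm1 : 1 ≤ m) (hmn : m ≤ n)
    (m' : Fin n) (hm' : (m' : ℕ) = m - 1)
    (ξ : 𝔤) (X Y : Fin n → 𝔤)
    (b : Module.Basis (Unit ⊕ Fin n ⊕ Fin n) ℝ 𝔤)
    (hbξ : b (Sum.inl ()) = ξ)
    (hbX : ∀ i, b (Sum.inr (Sum.inl i)) = X i)
    (hbY : ∀ i, b (Sum.inr (Sum.inr i)) = Y i)
    -- the only non-vanishing Lie brackets among basis vectors: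
    (brξX : ∀ i : Fin n, ⁅ξ, X i⁆ = if (i : ℕ) < m then Y i else 0)
    (brξY : ∀ i : Fin n, ⁅ξ, Y i⁆ = 0)
    (brXX : ∀ i j : Fin n, ⁅X i, X j⁆ = 0)
    (brYY : ∀ i j : Fin n, ⁅Y i, Y j⁆ = 0)
    (brXY : ∀ i j : Fin n, ⁅X i, Y j⁆ =
      if (i : ℕ) < m then
        (if (j : ℕ) < m then
          (if i = j then
            (2 : ℝ) • ξ + (Real.sqrt 2 * (1 + (if i = m' then (1 : ℝ) else 0))) • Y m'
          else
            (Real.sqrt 2 * (if i = m' then (1 : ℝ) else 0)) • Y j +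
              (Real.sqrt 2 * (if j = m' then (1 : ℝ) else 0)) • Y i)
        else Real.sqrt 2 • Y i)
      else
        (if (j : ℕ) < m then 0
         else if i = j then (2 : ℝ) • ξ + Real.sqrt 2 • Y i else 0))
    -- the structure tensor φ:
    (φ : 𝔤 →ₗ[ℝ] 𝔤)
    (hφξ : φ ξ = 0)
    (hφX : ∀ i, φ (X i) = X i)
    (hφY : ∀ i, φ (Y i) = -Y i)
    -- the tensor h = ½ L_ξ φ:
    (h : 𝔤 →ₗ[ℝ] 𝔤)
    (hdef : ∀ x : 𝔤, h x = (1 / 2 : ℝ) • (⁅ξ, φ x⁆ - φ ⁅ξ, x⁆)) :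
    (∀ i : Fin n, (i : ℕ) < m → h (X i) = Y i) ∧
    (∀ i : Fin n, m ≤ (i : ℕ) → h (X i) = 0) ∧
    (∀ i : Fin n, h (Y i) = 0) ∧
    h ξ = 0 ∧
    h ∘ₗ h = 0 ∧
    h ≠ 0 ∧
    Module.finrank ℝ (LinearMap.range h) = m := by
  have hX1 : ∀ i : Fin n, (i : ℕ) < m → h (X i) = Y i := by
    intro i hi
    rw [hdef, hφX, brξX, if_pos hi, hφY, sub_neg_eq_add, ← two_smul ℝ, smul_smul]
    norm_num
  have hX2 : ∀ i : Fin n, m ≤ (i : ℕ) → h (X i) = 0 := by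
    intro i hi
    rw [hdef, hφX, brξX, if_neg (not_lt.mpr hi)]
    simp
  have hY : ∀ i : Fin n, h (Y i) = 0 := by
    intro i
    rw [hdef, hφY, lie_neg, brξY]
    simp
  have hξ : h ξ = 0 := by
    rw [hdef, hφξ, lie_self]
    simp
  have hY0 : Y m' ≠ 0 := by
    rw [← hbY]
    exact b.ne_zero _
  have hm'm : (m' : ℕ) < m := by omega
  refine ⟨hX1, hX2, hY, hξ, ?_, ?_, ?_⟩
  · apply b.ext
    rintro (u | i | i)
    · cases u
      simp [hbξ, hξ]
    · by_cases hi : (i : ℕ) < m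
      · simp [hbX, hX1 i hi, hY]
      · simp [hbX, hX2 i (not_lt.mp hi)]
    · simp [hbY, hY]
  · intro h0
    apply hY0
    rw [← hX1 m' hm'm, h0]
    simp
  · have hli : LinearIndependent ℝ (fun i : Fin m => Y (Fin.castLE hmn i)) := by
      have := b.linearIndependent.comp
        (fun i : Fin m => (Sum.inr (Sum.inr (Fin.castLE hmn i)) : Unit ⊕ Fin n ⊕ Fin n))
        (fun i j hij => by simpa using hij)
      convert this using 1
      funext i
      simp [hbY]
    have hr : LinearMap.range h
        = Submodule.span ℝ (Set.range (fun i : Fin m => Y (Fin.castLE hmn i))) := by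
      apply le_antisymm
      · rw [LinearMap.range_eq_map, ← b.span_eq, Submodule.map_span, Submodule.span_le]
        rintro _ ⟨_, ⟨u | i | i, rfl⟩, rfl⟩
        · cases u
          simp [hbξ, hξ]
        · by_cases hi : (i : ℕ) < m
          · rw [hbX, hX1 i hi]
            exact Submodule.subset_span ⟨⟨i, hi⟩, rfl⟩
          · simp [hbX, hX2 i (not_lt.mp hi)]
        · simp [hbY, hY]
      · rw [Submodule.span_le]
        rintro _ ⟨i, rfl⟩
        exact ⟨X (Fin.castLE hmn i), hX1 _ (by simp)⟩
    rw [hr, finrank_span_eq_card hli, Fintype.card_fin]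
end

section
/- Let n ≥ 1, 1 ≤ m ≤ n, and let 𝔤 be the (2n+1)-dimensional real Lie algebra with basis {ξ, X₁, Y₁, …, Xₙ, Yₙ} whose only non-vanishing Lie brackets among basis vectors are: [ξ, Xᵢ] = Yᵢ for i = 1,…,m; [Xᵢ, Yⱼ] = δᵢⱼ(2ξ + √2(1+δᵢₘ)Yₘ) + (1−δᵢⱼ)√2(δᵢₘYⱼ + δⱼₘYᵢ) for i,j = 1,…,m; [Xᵢ, Yⱼ] = δᵢⱼ(2ξ + √2Yᵢ) for i,j = m+1,…,n; and [Xᵢ, Yⱼ] = √2 Yᵢ for i = 1,…,m and j = m+1,…,n. Let g be the symmetric bilinear form whose only non-vanishing values on basis vectors are g(ξ,ξ) = 1 and g(Xᵢ,Yᵢ) = 1 for all i, set η(X) = g(X,ξ), let h : 𝔤 → 𝔤 be the linear map with h Xᵢ = Yᵢ for i ≤ m and h Xᵢ = 0 for i > m, h Yᵢ = 0 for all i, h ξ = 0, and let ∇ be the Levi-Civita product of (𝔤,g) with curvature R. Then R(X,Y)ξ = −(η(Y)X − η(X)Y) + 2(η(Y)hX − η(X)hY) for all X,Y ∈ 𝔤,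 i.e. the structure is a paracontact metric (κ,μ)-space with κ = −1 and μ = 2. -/
set_option maxHeartbeats 1000000

theorem basis_pred {ι V : Type*} [AddCommGroup V] [Module ℝ V] (b : Module.Basis ι ℝ V)
    (P : V → Prop) (hb : ∀ i, P (b i)) (h0 : P 0) (ha : ∀ x y, P x → P y → P (x + y))
    (hs : ∀ (a : ℝ) x, P x → P (a • x)) (x : V) : P x := by
  have hx : x ∈ Submodule.span ℝ (Set.range b) := by simp [b.span_eq]
  induction hx using Submodule.span_induction with
  | mem x hx => obtain ⟨i, rfl⟩ := hx; exact hb i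
  | zero => exact h0
  | add x y _ _ hx hy => exact ha x y hx hy
  | smul a x _ hx => exact hs a x hx


theorem struct_consts (n m : ℕ) (m' : Fin n) (hm : (m' : ℕ) < m)
    (c : Fin n → Fin n → Fin n → ℝ)
    (hc' : ∀ i j k, c i j k = if (i : ℕ) < m then
        (if (j : ℕ) < m then
          (if i = j then
            (Real.sqrt 2 * (1 + (if i = m' then (1 : ℝ) else 0))) * (if m' = k then 1 else 0)
          else
            (Real.sqrt 2 * (if i = m' then (1 : ℝ) else 0)) * (if j = k then 1 else 0) +
              (Real.sqrt 2 * (if j = m' then (1 : ℝ) else 0)) * (if i = k then 1 else 0))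
        else Real.sqrt 2 * (if i = k then 1 else 0))
      else
        (if (j : ℕ) < m then 0
         else if i = j then Real.sqrt 2 * (if i = k then 1 else 0) else 0)) :
    (∀ i j k : Fin n, c i j k = c k j i) ∧
    (∀ i j k : Fin n, (i : ℕ) < m → (j : ℕ) < m → c i j k = c j i k) ∧
    (∀ i j k : Fin n, ¬ (i : ℕ) < m → (j : ℕ) < m → c i j k = 0) := by
  refine ⟨?_, ?_, ?_⟩
  · intro i j k
    rw [hc', hc']
    clear hc'
    grind
  · intro i j k hi hj
    rw [hc', hc']
    clear hc'
    grind
  · intro i j k hi hj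
    rw [hc', if_neg hi, if_pos hj]

/-- The paper's Example 4.2: the `(2n+1)`-dimensional Lie group example is a
paracontact metric `(κ,μ)`-space with `κ = -1`, `μ = 2`:
`R(x,y)ξ = -(η(y)x - η(x)y) + 2(η(y)hx - η(x)hy)`. Indices are 0-based:
`i.val < m` means `i ∈ {1,…,m}` and `m'` is the index of `Xₘ, Yₘ`. -/
theorem curvature_example_mu2_rank_m
    (𝔤 : Type*) [LieRing 𝔤] [LieAlgebra ℝ 𝔤]
    (n m : ℕ) (hm1 : 1 ≤ m) (hmn : m ≤ n)
    (m' : Fin n) (hm' : (m' : ℕ) = m - 1)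
    (ξ : 𝔤) (X Y : Fin n → 𝔤)
    (b : Module.Basis (Unit ⊕ Fin n ⊕ Fin n) ℝ 𝔤)
    (hbξ : b (Sum.inl ()) = ξ)
    (hbX : ∀ i, b (Sum.inr (Sum.inl i)) = X i)
    (hbY : ∀ i, b (Sum.inr (Sum.inr i)) = Y i)
    -- the only non-vanishing Lie brackets among basis vectors:
    (brξX : ∀ i : Fin n, ⁅ξ, X i⁆ = if (i : ℕ) < m then Y i else 0)
    (brξY : ∀ i : Fin n, ⁅ξ, Y i⁆ = 0)
    (brXX : ∀ i j : Fin n, ⁅X i, X j⁆ = 0)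
    (brYY : ∀ i j : Fin n, ⁅Y i, Y j⁆ = 0)
    (brXY : ∀ i j : Fin n, ⁅X i, Y j⁆ =
      if (i : ℕ) < m then
        (if (j : ℕ) < m then
          (if i = j then
            (2 : ℝ) • ξ + (Real.sqrt 2 * (1 + (if i = m' then (1 : ℝ) else 0))) • Y m'
          else
            (Real.sqrt 2 * (if i = m' then (1 : ℝ) else 0)) • Y j +
              (Real.sqrt 2 * (if j = m' then (1 : ℝ) else 0)) • Y i)
        else Real.sqrt 2 • Y i)
      else
        (if (j : ℕ) < m then 0
         else if i = j then (2 : ℝ) • ξ + Real.sqrt 2 • Y i else 0))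
    -- the symmetric bilinear form:
    (g : 𝔤 →ₗ[ℝ] 𝔤 →ₗ[ℝ] ℝ) (hgsymm : ∀ x y : 𝔤, g x y = g y x)
    (hg1 : g ξ ξ = 1)
    (hg2 : ∀ i, g ξ (X i) = 0)
    (hg3 : ∀ i, g ξ (Y i) = 0)
    (hg4 : ∀ i j, g (X i) (X j) = 0)
    (hg5 : ∀ i j, g (Y i) (Y j) = 0)
    (hg6 : ∀ i j, g (X i) (Y j) = if i = j then 1 else 0)
    (η : 𝔤 → ℝ) (hη : ∀ x, η x = g x ξ)
    -- the tensor h: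
    (h : 𝔤 →ₗ[ℝ] 𝔤)
    (hhX1 : ∀ i : Fin n, (i : ℕ) < m → h (X i) = Y i)
    (hhX2 : ∀ i : Fin n, m ≤ (i : ℕ) → h (X i) = 0)
    (hhY : ∀ i, h (Y i) = 0)
    (hhξ : h ξ = 0)
    -- Levi-Civita product and curvature:
    (nabla : 𝔤 →ₗ[ℝ] 𝔤 →ₗ[ℝ] 𝔤)
    (hkoszul : ∀ x y z : 𝔤,
      2 * g (nabla x y) z = g ⁅x, y⁆ z - g ⁅y, z⁆ x + g ⁅z, x⁆ y)
    (R : 𝔤 → 𝔤 → 𝔤 → 𝔤)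
    (hR : ∀ x y z : 𝔤,
      R x y z = nabla x (nabla y z) - nabla y (nabla x z) - nabla ⁅x, y⁆ z) :
    ∀ x y : 𝔤,
      R x y ξ = -(η y • x - η x • y) + (2 : ℝ) • (η y • h x - η x • h y) := by
  -- basis induction in terms of ξ, X, Y
  have ind : ∀ P : 𝔤 → Prop, P ξ → (∀ i, P (X i)) → (∀ i, P (Y i)) → P 0 →
      (∀ x y, P x → P y → P (x + y)) → (∀ (a : ℝ) x, P x → P (a • x)) → ∀ x, P x := by
    intro P h1 h2 h3 h0 ha hs
    refine basis_pred b P ?_ h0 ha hs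
    rintro (⟨⟨⟩⟩ | i | i)
    · rw [hbξ]; exact h1
    · rw [hbX]; exact h2 i
    · rw [hbY]; exact h3 i
  have hg2' : ∀ i, g (X i) ξ = 0 := fun i => by rw [hgsymm, hg2]
  have hg3' : ∀ i, g (Y i) ξ = 0 := fun i => by rw [hgsymm, hg3]
  have hg6' : ∀ i j, g (Y i) (X j) = if i = j then 1 else 0 := fun i j => by
    rw [hgsymm, hg6]; simp only [eq_comm]
  -- nondegeneracy
  have nd0 : ∀ v, (g v ξ = 0) → (∀ i, g v (X i) = 0) → (∀ i, g v (Y i) = 0) → v = 0 := by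
    intro v h1 h2 h3
    have e := b.sum_repr v
    rw [Fintype.sum_sum_type, Fintype.sum_sum_type] at e
    simp only [Finset.univ_unique, Finset.sum_singleton, hbX, hbY] at e
    have hbξ' : b (Sum.inl default) = ξ := hbξ
    rw [hbξ'] at e
    have k1 := h1
    have k2 := h2
    have k3 := h3
    rw [← e] at k1 k2 k3
    simp [hg1, hg2, hg3, hg4, hg5, hg6, hg2', hg3', hg6'] at k1 k2 k3
    rw [← e]
    simp [k1, k2, k3]
  have nd : ∀ v w, (g v ξ = g w ξ) → (∀ i, g v (X i) = g w (X i)) →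
      (∀ i, g v (Y i) = g w (Y i)) → v = w := by
    intro v w h1 h2 h3
    rw [← sub_eq_zero]
    apply nd0
    · simp [h1]
    · simp [h2]
    · simp [h3]
  have brYX : ∀ i j, ⁅Y i, X j⁆ = -⁅X j, Y i⁆ := fun i j => (lie_skew _ _).symm
  have brXξ : ∀ i, ⁅X i, ξ⁆ = -⁅ξ, X i⁆ := fun i => (lie_skew _ _).symm
  have brYξ : ∀ i, ⁅Y i, ξ⁆ = 0 := fun i => by rw [← lie_skew, brξY, neg_zero]
  have cξ : ∀ i j, g ⁅X i, Y j⁆ ξ = if i = j then 2 else 0 := by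
    intro i j
    rw [brXY]
    by_cases hij : i = j
    · subst hij
      split_ifs <;> simp [hg1, hg3']
    · simp only [if_neg hij]
      split_ifs <;> simp [hg3']
  have cY : ∀ i j k, g ⁅X i, Y j⁆ (Y k) = 0 := by
    intro i j k
    rw [brXY]
    split_ifs <;> simp [hg5, hg3]
  have cξ' : ∀ i j, g ⁅Y i, X j⁆ ξ = - if j = i then 2 else 0 := by
    intro i j
    rw [brYX, map_neg, LinearMap.neg_apply, cξ]
  have cY' : ∀ i j k, g ⁅Y i, X j⁆ (Y k) = 0 := by
    intro i j k
    rw [brYX, map_neg, LinearMap.neg_apply, cY, neg_zero]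
  have m'lt : (m' : ℕ) < m := by omega
  obtain ⟨c, hc⟩ : ∃ c : Fin n → Fin n → Fin n → ℝ, ∀ i j k, g ⁅X i, Y j⁆ (X k) = c i j k :=
    ⟨_, fun _ _ _ => rfl⟩
  -- symmetry properties of the structure constants
  have hc' : ∀ i j k, c i j k = if (i : ℕ) < m then
        (if (j : ℕ) < m then
          (if i = j then
            (Real.sqrt 2 * (1 + (if i = m' then (1 : ℝ) else 0))) * (if m' = k then 1 else 0)
          else
            (Real.sqrt 2 * (if i = m' then (1 : ℝ) else 0)) * (if j = k then 1 else 0) +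
              (Real.sqrt 2 * (if j = m' then (1 : ℝ) else 0)) * (if i = k then 1 else 0))
        else Real.sqrt 2 * (if i = k then 1 else 0))
      else
        (if (j : ℕ) < m then 0
         else if i = j then Real.sqrt 2 * (if i = k then 1 else 0) else 0) := by
    intro i j k
    rw [← hc, brXY]
    simp only [apply_ite (fun v => g v (X k)), map_add, map_smul, map_zero, LinearMap.add_apply,
      LinearMap.smul_apply, LinearMap.zero_apply, smul_eq_mul, hg2, hg6', mul_zero, zero_add]
  obtain ⟨c13, c12, c0⟩ := struct_consts n m m' m'lt c hc'
  clear hc'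
  -- torsion-free
  have tf : ∀ x y, nabla x y - nabla y x = ⁅x, y⁆ := by
    intro x y
    have : ∀ z, g (nabla x y - nabla y x) z = g ⁅x, y⁆ z := by
      intro z
      have h1 := hkoszul x y z
      have h2 := hkoszul y x z
      rw [← lie_skew y x, ← lie_skew x z, ← lie_skew z y] at h2
      simp only [map_neg, LinearMap.neg_apply, map_sub, LinearMap.sub_apply] at h2 ⊢
      linarith
    exact nd _ _ (this _) (fun _ => this _) (fun _ => this _)
  have K : ∀ x y z, g (nabla x y) z = (g ⁅x, y⁆ z - g ⁅y, z⁆ x + g ⁅z, x⁆ y) / 2 := by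
    intro x y z
    linarith [hkoszul x y z]
  have nξ : nabla ξ ξ = 0 := by
    apply nd0
    · simp [K]
    · intro i; simp only [K, brXξ, brξX]; split_ifs <;> simp [hg3']
    · intro i; simp [K, brξY, brYξ]
  have nX : ∀ i, nabla (X i) ξ = - X i - (if (i : ℕ) < m then Y i else 0) := by
    intro i
    apply nd
    · simp only [K, brXξ, brξX]; split_ifs <;> simp [hg3', hg2']
    · intro j; simp only [K, brXξ, brξX, brXX]
      by_cases hij : i = j
      · subst hij
        by_cases hi : (i : ℕ) < m <;> simp [hi, hg6', hg4] <;> norm_num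
      · have hji : ¬ j = i := fun e => hij e.symm
        by_cases hi : (i : ℕ) < m <;> by_cases hj : (j : ℕ) < m <;> simp [hi, hj, hij, hji, hg6', hg4]
    · intro j; simp only [K, brXξ, brξX, brξY, brYX]
      by_cases hij : i = j
      · subst hij
        by_cases hi : (i : ℕ) < m <;> simp [hi, hg6, hg5, cξ, cξ'] <;> norm_num
      · have hji : ¬ j = i := fun e => hij e.symm
        by_cases hi : (i : ℕ) < m <;> by_cases hj : (j : ℕ) < m <;> simp [hi, hj, hij, hji, hg6, hg5, cξ, cξ']
  have nY : ∀ i, nabla (Y i) ξ = Y i := by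
    intro i
    apply nd
    · simp [K, brYξ, brξY, hg3']
    · intro j; simp only [K, brYξ, brξX, cξ]
      by_cases hij : i = j
      · subst hij
        by_cases hi : (i : ℕ) < m <;> simp [hi, hg6', hg5] <;> norm_num
      · have hji : ¬ j = i := fun e => hij e.symm
        by_cases hi : (i : ℕ) < m <;> by_cases hj : (j : ℕ) < m <;> simp [hi, hj, hij, hji, hg6', hg5]
    · intro j; simp [K, brYξ, brξY, brYY, hg5]
  have nBr : ∀ i j, nabla ⁅X i, Y j⁆ ξ = ⁅X i, Y j⁆ - (if i = j then (2 : ℝ) else 0) • ξ := by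
    intro i j
    rw [brXY]
    by_cases hij : i = j
    · subst hij
      split_ifs <;> simp [nξ, nY]
    · simp only [if_neg hij]
      split_ifs <;> simp [nY]
  have nξX : ∀ i, nabla ξ (X i) = - X i := by
    intro i
    have := tf ξ (X i)
    rw [nX, brξX] at this
    rw [sub_eq_iff_eq_add] at this
    rw [this]; abel
  have nξY : ∀ i, nabla ξ (Y i) = Y i := by
    intro i
    have := tf ξ (Y i)
    rw [nY, brξY, sub_eq_zero] at this
    exact this
  have hhX : ∀ i, h (X i) = if (i : ℕ) < m then Y i else 0 := by
    intro i
    split_ifs with hi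
    · exact hhX1 i hi
    · exact hhX2 i (by omega)
  -- predicate
  have anti : ∀ x y, R x y ξ = -(η y • x - η x • y) + (2 : ℝ) • (η y • h x - η x • h y) →
      R y x ξ = -(η x • y - η y • x) + (2 : ℝ) • (η x • h y - η y • h x) := by
    intro x y hxy
    have : R y x ξ = - R x y ξ := by
      rw [hR, hR, ← lie_skew y x, map_neg, LinearMap.neg_apply]; abel
    rw [this, hxy]; module
  have eξξ : R ξ ξ ξ = -(η ξ • ξ - η ξ • ξ) + (2 : ℝ) • (η ξ • h ξ - η ξ • h ξ) := by
    simp [hR]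
  have eξX : ∀ i, R ξ (X i) ξ =
      -(η (X i) • ξ - η ξ • X i) + (2 : ℝ) • (η (X i) • h ξ - η ξ • h (X i)) := by
    intro i
    rw [hR, nX, nξ, brξX, hhX, hη, hη, hg2', hg1]
    split_ifs <;> simp [nξX, nξY, nY, hhξ] <;> module
  have eξY : ∀ i, R ξ (Y i) ξ =
      -(η (Y i) • ξ - η ξ • Y i) + (2 : ℝ) • (η (Y i) • h ξ - η ξ • h (Y i)) := by
    intro i
    rw [hR, nY, nξ, brξY, hhY, hη, hη, hg3', hg1]
    simp [nξY]
  have eYY : ∀ i j, R (Y i) (Y j) ξ =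
      -(η (Y j) • Y i - η (Y i) • Y j) + (2 : ℝ) • (η (Y j) • h (Y i) - η (Y i) • h (Y j)) := by
    intro i j
    rw [hR, nY, nY, tf, brYY, hη, hη, hg3', hg3']
    simp
  have nXYs : ∀ i j : Fin n, (i : ℕ) < m → (j : ℕ) < m → nabla (X i) (Y j) = nabla (X j) (Y i) := by
    intro i j hi hj
    apply nd
    · simp [K, brξX, brYξ, cξ, hg5, hi, hj, eq_comm]
    · intro k; simp only [K, brXX, brYX, hc, map_neg, LinearMap.neg_apply]
      simp only [map_zero, LinearMap.zero_apply]
      rw [c12 i j k hi hj, c13 k j i, c13 k i j, c12 i j k hi hj]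
    · intro k; simp [K, brYY, cY', cY]
  have nXY0 : ∀ i j : Fin n, ¬ (i : ℕ) < m → (j : ℕ) < m → nabla (X i) (Y j) = 0 := by
    intro i j hi hj
    have hij : i ≠ j := by rintro rfl; exact hi hj
    apply nd0
    · simp only [K, brξX, brYξ, cξ]; simp [hi, hij]
    · intro k; simp only [K, brXX, brYX, hc, map_neg, LinearMap.neg_apply]
      simp only [map_zero, LinearMap.zero_apply]
      rw [c13 k j i, c0 i j k hi hj]; simp
    · intro k; simp [K, brYY, cY', cY]
  have eXX : ∀ i j, R (X i) (X j) ξ =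
      -(η (X j) • X i - η (X i) • X j) + (2 : ℝ) • (η (X j) • h (X i) - η (X i) • h (X j)) := by
    intro i j
    have t := tf (X i) (X j)
    rw [brXX, sub_eq_zero] at t
    rw [hR, nX, nX, brXX, hη, hη, hg2', hg2']
    by_cases hi : (i : ℕ) < m <;> by_cases hj : (j : ℕ) < m
    · simp [hi, hj, t, nXYs i j hi hj]
    · simp [hi, hj, t, nXY0 j i hj hi]
    · simp [hi, hj, t, nXY0 i j hi hj]
    · simp [hi, hj, t]
  have nYY : ∀ i j, nabla (Y i) (Y j) = 0 := by
    intro i j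
    apply nd
    · simp [K, brξY, brYξ, brYY]
    · intro k; simp [K, brYY, cY', cY]
    · intro k; simp [K, brYY]
  have nYX : ∀ i j, nabla (Y j) (X i) = - (if i = j then (1 : ℝ) else 0) • ξ := by
    intro i j
    apply nd
    · simp only [K, brξY, brXξ, brYX, brξX, map_neg, LinearMap.neg_apply, cξ]
      split_ifs <;> simp [hg5, hg1]
    · intro k; simp only [K, brXX, brYX, hc, map_neg, LinearMap.neg_apply]
      rw [c13 k j i]; split_ifs <;> simp [hg2]
    · intro k; by_cases hij : i = j <;> simp [K, brYY, cY', cY, hg3, hij]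
  have eXY : ∀ i j, R (X i) (Y j) ξ =
      -(η (Y j) • X i - η (X i) • Y j) + (2 : ℝ) • (η (Y j) • h (X i) - η (X i) • h (Y j)) := by
    intro i j
    have t := tf (X i) (Y j)
    rw [sub_eq_iff_eq_add] at t
    rw [hR, nX, nY, nBr, t, hη, hη, hg2', hg3', map_sub, map_neg, nYX]
    have : nabla (Y j) (if (i : ℕ) < m then Y i else 0) = 0 := by
      split_ifs <;> simp [nYY]
    rw [this]
    split_ifs <;> simp <;> module
  have lin : ∀ x, (R x ξ ξ = -(η ξ • x - η x • ξ) + (2 : ℝ) • (η ξ • h x - η x • h ξ)) →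
      (∀ i, R x (X i) ξ = -(η (X i) • x - η x • X i) + (2 : ℝ) • (η (X i) • h x - η x • h (X i))) →
      (∀ i, R x (Y i) ξ = -(η (Y i) • x - η x • Y i) + (2 : ℝ) • (η (Y i) • h x - η x • h (Y i))) →
      ∀ y, R x y ξ = -(η y • x - η x • y) + (2 : ℝ) • (η y • h x - η x • h y) := by
    intro x h1 h2 h3
    refine ind _ h1 h2 h3 ?_ ?_ ?_
    · simp [hR, hη]
    · intro y z hy hz
      have : R x (y + z) ξ = R x y ξ + R x z ξ := by
        simp only [hR, lie_add, map_add, LinearMap.add_apply]; abel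
      rw [this, hy, hz]
      simp only [hη, map_add, LinearMap.add_apply]; module
    · intro a y hy
      have : R x (a • y) ξ = a • R x y ξ := by
        simp only [hR, lie_smul, map_smul, LinearMap.smul_apply]; module
      rw [this, hy]
      simp only [hη, map_smul, LinearMap.smul_apply, smul_eq_mul]; module
  have Lξ := lin ξ eξξ eξX eξY
  have LX := fun i => lin (X i) (anti _ _ (eξX i)) (eXX i) (eXY i)
  have LY := fun i => lin (Y i) (anti _ _ (eξY i)) (fun j => anti _ _ (eXY j i)) (eYY i)
  intro x
  exact lin x (anti _ _ (Lξ x)) (fun i => anti _ _ (LX i x)) (fun i => anti _ _ (LY i x))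
end

section
/- Let 𝔤 be the 5-dimensional real Lie algebra with basis {ξ, X₁, Y₁, X₂, Y₂} and Lie brackets [ξ,X₁] = Y₁ + X₁ + X₂, [ξ,Y₁] = −Y₁ + Y₂, [ξ,X₂] = Y₂ + X₁ + X₂, [ξ,Y₂] = Y₁ − Y₂, [X₁,Y₁] = 2ξ + X₂ + (3/2)Y₂, [X₂,Y₂] = −2ξ + X₁ − (1/2)Y₁, [X₁,X₂] = (3/2)X₁ + (1/2)X₂, [Y₁,Y₂] = −Y₁ + Y₂, [X₁,Y₂] = (3/2)Y₁ + X₂, [Y₁,X₂] = −X₁ + (1/2)Y₂. Let g be the symmetric bilinear form whose only non-vanishing values on basis vectors are g(ξ,ξ) = g(X₁,Y₁) = 1 and g(X₂,Y₂) = −1, set η(X) = g(X,ξ), let φ : 𝔤 → 𝔤 be the linear map with φξ = 0, φXᵢ = Xᵢ and φYᵢ = −Yᵢ for i = 1,2, define h : 𝔤 → 𝔤 by hX = ½([ξ, φX] − φ[ξ, X]), and let ∇ be the Levi-Civita product of (𝔤,g) with curvature R. Then h Xᵢ = Yᵢ and h Yᵢ = 0 for i = 1,2 and h ξ = 0 (so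 h ∘ h = 0 and rank h = 2), and R(X,Y)ξ = −(η(Y)X − η(X)Y) for all X,Y ∈ 𝔤, i.e. the structure is a paracontact metric (−1,0)-space with rank(h) = 2. -/
set_option linter.unusedSimpArgs false in
set_option maxHeartbeats 4000000 in

/-- The paper's Example 4.6: a 5-dimensional paracontact metric `(-1,0)`-space
with `rank h = 2`. -/
theorem example_dim5_mu0_rank2
    (𝔤 : Type*) [LieRing 𝔤] [LieAlgebra ℝ 𝔤]
    (ξ X1 Y1 X2 Y2 : 𝔤)
    (b : Module.Basis (Fin 5) ℝ 𝔤) (hb : ∀ i, b i = ![ξ, X1, Y1, X2, Y2] i)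
    -- the Lie brackets:
    (br1 : ⁅ξ, X1⁆ = Y1 + X1 + X2)
    (br2 : ⁅ξ, Y1⁆ = -Y1 + Y2)
    (br3 : ⁅ξ, X2⁆ = Y2 + X1 + X2)
    (br4 : ⁅ξ, Y2⁆ = Y1 - Y2)
    (br5 : ⁅X1, Y1⁆ = (2 : ℝ) • ξ + X2 + (3 / 2 : ℝ) • Y2)
    (br6 : ⁅X2, Y2⁆ = -((2 : ℝ) • ξ) + X1 - (1 / 2 : ℝ) • Y1)
    (br7 : ⁅X1, X2⁆ = (3 / 2 : ℝ) • X1 + (1 / 2 : ℝ) • X2)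
    (br8 : ⁅Y1, Y2⁆ = -Y1 + Y2)
    (br9 : ⁅X1, Y2⁆ = (3 / 2 : ℝ) • Y1 + X2)
    (br10 : ⁅Y1, X2⁆ = -X1 + (1 / 2 : ℝ) • Y2)
    -- the symmetric bilinear form:
    (g : 𝔤 →ₗ[ℝ] 𝔤 →ₗ[ℝ] ℝ) (hgsymm : ∀ x y : 𝔤, g x y = g y x)
    (hg1 : g ξ ξ = 1) (hg2 : g ξ X1 = 0) (hg3 : g ξ Y1 = 0) (hg4 : g ξ X2 = 0)
    (hg5 : g ξ Y2 = 0) (hg6 : g X1 X1 = 0) (hg7 : g X1 Y1 = 1) (hg8 : g X1 X2 = 0)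
    (hg9 : g X1 Y2 = 0) (hg10 : g Y1 Y1 = 0) (hg11 : g Y1 X2 = 0) (hg12 : g Y1 Y2 = 0)
    (hg13 : g X2 X2 = 0) (hg14 : g X2 Y2 = -1) (hg15 : g Y2 Y2 = 0)
    (η : 𝔤 → ℝ) (hη : ∀ x, η x = g x ξ)
    -- the structure tensor φ:
    (φ : 𝔤 →ₗ[ℝ] 𝔤)
    (hφξ : φ ξ = 0)
    (hφX1 : φ X1 = X1) (hφY1 : φ Y1 = -Y1)
    (hφX2 : φ X2 = X2) (hφY2 : φ Y2 = -Y2)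
    -- the tensor h = ½ L_ξ φ:
    (h : 𝔤 →ₗ[ℝ] 𝔤)
    (hdef : ∀ x : 𝔤, h x = (1 / 2 : ℝ) • (⁅ξ, φ x⁆ - φ ⁅ξ, x⁆))
    -- Levi-Civita product and curvature:
    (nabla : 𝔤 →ₗ[ℝ] 𝔤 →ₗ[ℝ] 𝔤)
    (hkoszul : ∀ x y z : 𝔤,
      2 * g (nabla x y) z = g ⁅x, y⁆ z - g ⁅y, z⁆ x + g ⁅z, x⁆ y)
    (R : 𝔤 → 𝔤 → 𝔤 → 𝔤)
    (hR : ∀ x y z : 𝔤,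
      R x y z = nabla x (nabla y z) - nabla y (nabla x z) - nabla ⁅x, y⁆ z) :
    h X1 = Y1 ∧ h X2 = Y2 ∧ h Y1 = 0 ∧ h Y2 = 0 ∧ h ξ = 0 ∧
    h ∘ₗ h = 0 ∧
    Module.finrank ℝ (LinearMap.range h) = 2 ∧
    ∀ x y : 𝔤, R x y ξ = -(η y • x - η x • y) := by
  have hrep : ∀ v : 𝔤, ∃ a0 a1 a2 a3 a4 : ℝ,
      v = a0 • ξ + a1 • X1 + a2 • Y1 + a3 • X2 + a4 • Y2 := by
    intro v
    refine ⟨b.repr v 0, b.repr v 1, b.repr v 2, b.repr v 3, b.repr v 4, ?_⟩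
    conv_lhs => rw [← b.sum_repr v]
    simp [Fin.sum_univ_five, hb]
  have q2 : g X1 ξ = 0 := by rw [hgsymm, hg2]
  have q3 : g Y1 ξ = 0 := by rw [hgsymm, hg3]
  have q4 : g X2 ξ = 0 := by rw [hgsymm, hg4]
  have q5 : g Y2 ξ = 0 := by rw [hgsymm, hg5]
  have q7 : g Y1 X1 = 1 := by rw [hgsymm, hg7]
  have q8 : g X2 X1 = 0 := by rw [hgsymm, hg8]
  have q9 : g Y2 X1 = 0 := by rw [hgsymm, hg9]
  have q11 : g X2 Y1 = 0 := by rw [hgsymm, hg11]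
  have q12 : g Y2 Y1 = 0 := by rw [hgsymm, hg12]
  have q14 : g Y2 X2 = -1 := by rw [hgsymm, hg14]
  have c1 : ⁅X1, ξ⁆ = -(Y1 + X1 + X2) := by rw [← lie_skew, br1]
  have c2 : ⁅Y1, ξ⁆ = -(-Y1 + Y2) := by rw [← lie_skew, br2]
  have c3 : ⁅X2, ξ⁆ = -(Y2 + X1 + X2) := by rw [← lie_skew, br3]
  have c4 : ⁅Y2, ξ⁆ = -(Y1 - Y2) := by rw [← lie_skew, br4]
  have c5 : ⁅Y1, X1⁆ = -((2 : ℝ) • ξ + X2 + (3 / 2 : ℝ) • Y2) := by rw [← lie_skew, br5]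
  have c6 : ⁅Y2, X2⁆ = -(-((2 : ℝ) • ξ) + X1 - (1 / 2 : ℝ) • Y1) := by rw [← lie_skew, br6]
  have c7 : ⁅X2, X1⁆ = -((3 / 2 : ℝ) • X1 + (1 / 2 : ℝ) • X2) := by rw [← lie_skew, br7]
  have c8 : ⁅Y2, Y1⁆ = -(-Y1 + Y2) := by rw [← lie_skew, br8]
  have c9 : ⁅Y2, X1⁆ = -((3 / 2 : ℝ) • Y1 + X2) := by rw [← lie_skew, br9]
  have c10 : ⁅X2, Y1⁆ = -(-X1 + (1 / 2 : ℝ) • Y2) := by rw [← lie_skew, br10]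
  -- nondegeneracy: a vector is recovered from its products with the basis
  have hnd : ∀ v : 𝔤, v = g v ξ • ξ + g v Y1 • X1 + g v X1 • Y1
      + (-g v Y2) • X2 + (-g v X2) • Y2 := by
    intro v
    obtain ⟨a0, a1, a2, a3, a4, rfl⟩ := hrep v
    simp only [map_add, map_smul, LinearMap.add_apply, LinearMap.smul_apply, smul_eq_mul,
      hg1, hg2, hg3, hg4, hg5, hg6, hg7, hg8, hg9, hg10, hg11, hg12, hg13, hg14, hg15,
      q2, q3, q4, q5, q7, q8, q9, q11, q12, q14]
    module
  have hN : ∀ x y : 𝔤, nabla x y =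
      ((g ⁅x, y⁆ ξ - g ⁅y, ξ⁆ x + g ⁅ξ, x⁆ y) / 2) • ξ
      + ((g ⁅x, y⁆ Y1 - g ⁅y, Y1⁆ x + g ⁅Y1, x⁆ y) / 2) • X1
      + ((g ⁅x, y⁆ X1 - g ⁅y, X1⁆ x + g ⁅X1, x⁆ y) / 2) • Y1
      + (-((g ⁅x, y⁆ Y2 - g ⁅y, Y2⁆ x + g ⁅Y2, x⁆ y) / 2)) • X2
      + (-((g ⁅x, y⁆ X2 - g ⁅y, X2⁆ x + g ⁅X2, x⁆ y) / 2)) • Y2 := by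
    intro x y
    have e : ∀ z, g (nabla x y) z = (g ⁅x, y⁆ z - g ⁅y, z⁆ x + g ⁅z, x⁆ y) / 2 := by
      intro z
      linarith [hkoszul x y z]
    conv_lhs => rw [hnd (nabla x y)]
    simp only [e]
  -- the Levi-Civita product on the basis
  obtain ⟨n00, n01, n02, n03, n04,
    n10, n11, n12, n13, n14,
    n20, n21, n22, n23, n24,
    n30, n31, n32, n33, n34,
    n40, n41, n42, n43, n44⟩ :
      nabla ξ ξ = 0 ∧
      nabla ξ X1 = (1 : ℝ) • X2 ∧
      nabla ξ Y1 = (1 : ℝ) • Y2 ∧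
      nabla ξ X2 = (1 : ℝ) • X1 ∧
      nabla ξ Y2 = (1 : ℝ) • Y1 ∧
      nabla X1 ξ = (-1 : ℝ) • X1 + (-1 : ℝ) • Y1 ∧
      nabla X1 X1 = (1 : ℝ) • ξ + (3/2 : ℝ) • X2 ∧
      nabla X1 Y1 = (1 : ℝ) • ξ + (3/2 : ℝ) • Y2 ∧
      nabla X1 X2 = (3/2 : ℝ) • X1 ∧
      nabla X1 Y2 = (3/2 : ℝ) • Y1 ∧
      nabla Y1 ξ = (1 : ℝ) • Y1 ∧
      nabla Y1 X1 = (-1 : ℝ) • ξ + (-1 : ℝ) • X2 ∧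
      nabla Y1 Y1 = (-1 : ℝ) • Y2 ∧
      nabla Y1 X2 = (-1 : ℝ) • X1 ∧
      nabla Y1 Y2 = (-1 : ℝ) • Y1 ∧
      nabla X2 ξ = (-1 : ℝ) • X2 + (-1 : ℝ) • Y2 ∧
      nabla X2 X1 = (-1/2 : ℝ) • X2 ∧
      nabla X2 Y1 = (-1/2 : ℝ) • Y2 ∧
      nabla X2 X2 = (-1 : ℝ) • ξ + (-1/2 : ℝ) • X1 ∧
      nabla X2 Y2 = (-1 : ℝ) • ξ + (-1/2 : ℝ) • Y1 ∧
      nabla Y2 ξ = (1 : ℝ) • Y2 ∧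
      nabla Y2 X1 = (-1 : ℝ) • X2 ∧
      nabla Y2 Y1 = (-1 : ℝ) • Y2 ∧
      nabla Y2 X2 = (1 : ℝ) • ξ + (-1 : ℝ) • X1 ∧
      nabla Y2 Y2 = (-1 : ℝ) • Y1 := by
    refine ⟨?_, ?_, ?_, ?_, ?_,
      ?_, ?_, ?_, ?_, ?_,
      ?_, ?_, ?_, ?_, ?_,
      ?_, ?_, ?_, ?_, ?_,
      ?_, ?_, ?_, ?_, ?_⟩
    all_goals
      rw [hN]
      simp only [br1, br2, br3, br4, br5, br6, br7, br8, br9, br10, c1, c2, c3, c4, c5, c6, c7, c8,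
      c9, c10, lie_self, map_add, map_sub, map_neg, map_zero, map_smul, LinearMap.add_apply,
      LinearMap.sub_apply, LinearMap.neg_apply, LinearMap.zero_apply, LinearMap.smul_apply,
      smul_eq_mul, hg1, hg2, hg3, hg4, hg5, hg6, hg7, hg8, hg9, hg10, hg11, hg12, hg13, hg14,
      hg15, q2, q3, q4, q5, q7, q8, q9, q11, q12, q14]
      module
  have h1 : h X1 = Y1 := by
    rw [hdef, hφX1, br1]
    simp only [map_add, hφX1, hφY1, hφX2]
    module
  have h2 : h X2 = Y2 := by
    rw [hdef, hφX2, br3]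
    simp only [map_add, hφX1, hφY2, hφX2]
    module
  have h3 : h Y1 = 0 := by
    rw [hdef, hφY1, lie_neg, br2]
    simp only [map_add, map_neg, hφY1, hφY2]
    module
  have h4 : h Y2 = 0 := by
    rw [hdef, hφY2, lie_neg, br4]
    simp only [map_sub, hφY1, hφY2]
    module
  have h5 : h ξ = 0 := by
    rw [hdef, hφξ, lie_self]
    simp
  refine ⟨h1, h2, h3, h4, h5, ?_, ?_, ?_⟩
  · ext v
    obtain ⟨a0, a1, a2, a3, a4, rfl⟩ := hrep v
    simp [h1, h2, h3, h4, h5]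
  · have hr : LinearMap.range h = Submodule.span ℝ (Set.range ![Y1, Y2]) := by
      apply le_antisymm
      · rintro _ ⟨v, rfl⟩
        obtain ⟨a0, a1, a2, a3, a4, rfl⟩ := hrep v
        simp only [map_add, map_smul, h1, h2, h3, h4, h5, smul_zero, add_zero, zero_add]
        exact add_mem (Submodule.smul_mem _ _ (Submodule.subset_span ⟨0, rfl⟩))
          (Submodule.smul_mem _ _ (Submodule.subset_span ⟨1, rfl⟩))
      · rw [Submodule.span_le]
        rintro _ ⟨i, rfl⟩
        fin_cases i
        · exact ⟨X1, h1⟩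
        · exact ⟨X2, h2⟩
    have li : LinearIndependent ℝ ![Y1, Y2] := by
      rw [LinearIndependent.pair_iff]
      intro s t hst
      have e1 := congrArg (fun v => g v X1) hst
      have e2 := congrArg (fun v => g v X2) hst
      simp [q7, q9, hg11, q14] at e1 e2
      exact ⟨e1, e2⟩
    rw [hr, finrank_span_eq_card li]
    simp
  · intro x y
    obtain ⟨a0, a1, a2, a3, a4, rfl⟩ := hrep x
    obtain ⟨b0, b1, b2, b3, b4, rfl⟩ := hrep y
    rw [hR, hη, hη]
    simp only [lie_add, add_lie, lie_smul, smul_lie]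
    simp only [br1, br2, br3, br4, br5, br6, br7, br8, br9, br10, c1, c2, c3, c4, c5, c6, c7, c8,
      c9, c10, lie_self, map_add, map_sub, map_neg, map_zero, map_smul, LinearMap.add_apply,
      LinearMap.sub_apply, LinearMap.neg_apply, LinearMap.zero_apply, LinearMap.smul_apply,
      smul_eq_mul, hg1, hg2, hg3, hg4, hg5, hg6, hg7, hg8, hg9, hg10, hg11, hg12, hg13, hg14,
      hg15, q2, q3, q4, q5, q7, q8, q9, q11, q12, q14]
    simp only [n00, n01, n02, n03, n04, n10, n11, n12, n13, n14, n20, n21, n22, n23, n24, n30, n31, n32, n33, n34, n40, n41, n42, n43, n44, map_add, map_sub, map_neg, map_zero, map_smul, LinearMap.add_apply,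
      LinearMap.smul_apply]
    module
end

section
/- Let 𝔤 be the 7-dimensional real Lie algebra with basis {ξ, X₁, Y₁, X₂, Y₂, X₃, Y₃} whose only non-vanishing Lie brackets among basis vectors are [ξ,X₁] = Y₁ + X₁ + X₂, [ξ,Y₁] = −Y₁ + Y₂, [ξ,X₂] = Y₂ + X₁ + X₂, [ξ,Y₂] = Y₁ − Y₂, [ξ,X₃] = X₃ + Y₃, [ξ,Y₃] = −Y₃, [X₁,Y₁] = 2ξ + √2(X₂ + Y₂), [X₂,Y₂] = −2ξ + √2 X₁, [X₃,Y₃] = −2ξ + √2(X₁ − X₂ − Y₂), [X₁,X₂] = −[Y₁,X₂] = √2 X₁, [X₁,Y₂] = √2(Y₁ + X₂), [Y₁,Y₂] = √2(−Y₁ + Y₂), [X₁,Y₃] = −[X₂,X₃] = [X₂,Y₃] = √2 X₃, [Y₁,Y₃] = −[Y₂,X₃] = [Y₂,Y₃] = √2 Y₃. Let g be the symmetric bilinear form whose only non-vanishing values on basis vectors are g(ξ,ξ) = g(X₁,Y₁) = 1 and g(X₂,Y₂) = g(X₃,Y₃) = −1, set η(X) = g(X,ξ), let φ : 𝔤 →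 𝔤 be the linear map with φξ = 0, φXᵢ = Xᵢ and φYᵢ = −Yᵢ for i = 1,2,3, define h : 𝔤 → 𝔤 by hX = ½([ξ, φX] − φ[ξ, X]), and let ∇ be the Levi-Civita product of (𝔤,g) with curvature R. Then h Xᵢ = Yᵢ and h Yᵢ = 0 for i = 1,2,3 and h ξ = 0 (so h ∘ h = 0 and rank h = 3), and R(X,Y)ξ = −(η(Y)X − η(X)Y) for all X,Y ∈ 𝔤, i.e. the structure is a paracontact metric (−1,0)-space with rank(h) = 3. -/
set_option linter.unusedSimpArgs false in
set_option maxHeartbeats 20000000 in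
/-- The paper's Example 4.8: a 7-dimensional paracontact metric `(-1,0)`-space
with `rank h = 3`. -/
theorem example_dim7_mu0_rank3
    (𝔤 : Type*) [LieRing 𝔤] [LieAlgebra ℝ 𝔤]
    (ξ X1 Y1 X2 Y2 X3 Y3 : 𝔤)
    (b : Module.Basis (Fin 7) ℝ 𝔤) (hb : ∀ i, b i = ![ξ, X1, Y1, X2, Y2, X3, Y3] i)
    -- the only non-vanishing Lie brackets among basis vectors:
    (br1 : ⁅ξ, X1⁆ = Y1 + X1 + X2)
    (br2 : ⁅ξ, Y1⁆ = -Y1 + Y2)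
    (br3 : ⁅ξ, X2⁆ = Y2 + X1 + X2)
    (br4 : ⁅ξ, Y2⁆ = Y1 - Y2)
    (br5 : ⁅ξ, X3⁆ = X3 + Y3)
    (br6 : ⁅ξ, Y3⁆ = -Y3)
    (br7 : ⁅X1, Y1⁆ = (2 : ℝ) • ξ + Real.sqrt 2 • (X2 + Y2))
    (br8 : ⁅X2, Y2⁆ = -((2 : ℝ) • ξ) + Real.sqrt 2 • X1)
    (br9 : ⁅X3, Y3⁆ = -((2 : ℝ) • ξ) + Real.sqrt 2 • (X1 - X2 - Y2))
    (br10 : ⁅X1, X2⁆ = Real.sqrt 2 • X1)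
    (br11 : ⁅Y1, X2⁆ = -(Real.sqrt 2 • X1))
    (br12 : ⁅X1, Y2⁆ = Real.sqrt 2 • (Y1 + X2))
    (br13 : ⁅Y1, Y2⁆ = Real.sqrt 2 • (-Y1 + Y2))
    (br14 : ⁅X1, Y3⁆ = Real.sqrt 2 • X3)
    (br15 : ⁅X2, X3⁆ = -(Real.sqrt 2 • X3))
    (br16 : ⁅X2, Y3⁆ = Real.sqrt 2 • X3)
    (br17 : ⁅Y1, Y3⁆ = Real.sqrt 2 • Y3)
    (br18 : ⁅Y2, X3⁆ = -(Real.sqrt 2 • Y3))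
    (br19 : ⁅Y2, Y3⁆ = Real.sqrt 2 • Y3)
    (br20 : ⁅X1, X3⁆ = 0)
    (br21 : ⁅Y1, X3⁆ = 0)
    -- the symmetric bilinear form:
    (g : 𝔤 →ₗ[ℝ] 𝔤 →ₗ[ℝ] ℝ) (hgsymm : ∀ x y : 𝔤, g x y = g y x)
    (hg1 : g ξ ξ = 1)
    (hg2 : g ξ X1 = 0) (hg3 : g ξ Y1 = 0) (hg4 : g ξ X2 = 0) (hg5 : g ξ Y2 = 0)
    (hg6 : g ξ X3 = 0) (hg7 : g ξ Y3 = 0)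
    (hg8 : g X1 Y1 = 1) (hg9 : g X2 Y2 = -1) (hg10 : g X3 Y3 = -1)
    (hg11 : g X1 X1 = 0) (hg12 : g Y1 Y1 = 0) (hg13 : g X2 X2 = 0)
    (hg14 : g Y2 Y2 = 0) (hg15 : g X3 X3 = 0) (hg16 : g Y3 Y3 = 0)
    (hg17 : g X1 X2 = 0) (hg18 : g X1 Y2 = 0) (hg19 : g X1 X3 = 0) (hg20 : g X1 Y3 = 0)
    (hg21 : g Y1 X2 = 0) (hg22 : g Y1 Y2 = 0) (hg23 : g Y1 X3 = 0) (hg24 : g Y1 Y3 = 0)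
    (hg25 : g X2 X3 = 0) (hg26 : g X2 Y3 = 0) (hg27 : g Y2 X3 = 0) (hg28 : g Y2 Y3 = 0)
    (η : 𝔤 → ℝ) (hη : ∀ x, η x = g x ξ)
    -- the structure tensor φ:
    (φ : 𝔤 →ₗ[ℝ] 𝔤)
    (hφξ : φ ξ = 0)
    (hφX1 : φ X1 = X1) (hφY1 : φ Y1 = -Y1)
    (hφX2 : φ X2 = X2) (hφY2 : φ Y2 = -Y2)
    (hφX3 : φ X3 = X3) (hφY3 : φ Y3 = -Y3)
    -- the tensor h = ½ L_ξ φ: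
    (h : 𝔤 →ₗ[ℝ] 𝔤)
    (hdef : ∀ x : 𝔤, h x = (1 / 2 : ℝ) • (⁅ξ, φ x⁆ - φ ⁅ξ, x⁆))
    -- Levi-Civita product and curvature:
    (nabla : 𝔤 →ₗ[ℝ] 𝔤 →ₗ[ℝ] 𝔤)
    (hkoszul : ∀ x y z : 𝔤,
      2 * g (nabla x y) z = g ⁅x, y⁆ z - g ⁅y, z⁆ x + g ⁅z, x⁆ y)
    (R : 𝔤 → 𝔤 → 𝔤 → 𝔤)
    (hR : ∀ x y z : 𝔤,
      R x y z = nabla x (nabla y z) - nabla y (nabla x z) - nabla ⁅x, y⁆ z) :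
    h X1 = Y1 ∧ h X2 = Y2 ∧ h X3 = Y3 ∧
    h Y1 = 0 ∧ h Y2 = 0 ∧ h Y3 = 0 ∧ h ξ = 0 ∧
    h ∘ₗ h = 0 ∧
    Module.finrank ℝ (LinearMap.range h) = 3 ∧
    ∀ x y : 𝔤, R x y ξ = -(η y • x - η x • y) := by
  have sX1ξ : g X1 ξ = 0 := by rw [hgsymm]; assumption
  have sY1ξ : g Y1 ξ = 0 := by rw [hgsymm]; assumption
  have sY1X1 : g Y1 X1 = 1 := by rw [hgsymm]; assumption
  have sX2ξ : g X2 ξ = 0 := by rw [hgsymm]; assumption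
  have sX2X1 : g X2 X1 = 0 := by rw [hgsymm]; assumption
  have sX2Y1 : g X2 Y1 = 0 := by rw [hgsymm]; assumption
  have sY2ξ : g Y2 ξ = 0 := by rw [hgsymm]; assumption
  have sY2X1 : g Y2 X1 = 0 := by rw [hgsymm]; assumption
  have sY2Y1 : g Y2 Y1 = 0 := by rw [hgsymm]; assumption
  have sY2X2 : g Y2 X2 = -1 := by rw [hgsymm]; assumption
  have sX3ξ : g X3 ξ = 0 := by rw [hgsymm]; assumption
  have sX3X1 : g X3 X1 = 0 := by rw [hgsymm]; assumption
  have sX3Y1 : g X3 Y1 = 0 := by rw [hgsymm]; assumption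
  have sX3X2 : g X3 X2 = 0 := by rw [hgsymm]; assumption
  have sX3Y2 : g X3 Y2 = 0 := by rw [hgsymm]; assumption
  have sY3ξ : g Y3 ξ = 0 := by rw [hgsymm]; assumption
  have sY3X1 : g Y3 X1 = 0 := by rw [hgsymm]; assumption
  have sY3Y1 : g Y3 Y1 = 0 := by rw [hgsymm]; assumption
  have sY3X2 : g Y3 X2 = 0 := by rw [hgsymm]; assumption
  have sY3Y2 : g Y3 Y2 = 0 := by rw [hgsymm]; assumption
  have sY3X3 : g Y3 X3 = -1 := by rw [hgsymm]; assumption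
  have rX1ξ : ⁅X1, ξ⁆ = -⁅ξ, X1⁆ := (lie_skew _ _).symm
  have rY1ξ : ⁅Y1, ξ⁆ = -⁅ξ, Y1⁆ := (lie_skew _ _).symm
  have rY1X1 : ⁅Y1, X1⁆ = -⁅X1, Y1⁆ := (lie_skew _ _).symm
  have rX2ξ : ⁅X2, ξ⁆ = -⁅ξ, X2⁆ := (lie_skew _ _).symm
  have rX2X1 : ⁅X2, X1⁆ = -⁅X1, X2⁆ := (lie_skew _ _).symm
  have rX2Y1 : ⁅X2, Y1⁆ = -⁅Y1, X2⁆ := (lie_skew _ _).symm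
  have rY2ξ : ⁅Y2, ξ⁆ = -⁅ξ, Y2⁆ := (lie_skew _ _).symm
  have rY2X1 : ⁅Y2, X1⁆ = -⁅X1, Y2⁆ := (lie_skew _ _).symm
  have rY2Y1 : ⁅Y2, Y1⁆ = -⁅Y1, Y2⁆ := (lie_skew _ _).symm
  have rY2X2 : ⁅Y2, X2⁆ = -⁅X2, Y2⁆ := (lie_skew _ _).symm
  have rX3ξ : ⁅X3, ξ⁆ = -⁅ξ, X3⁆ := (lie_skew _ _).symm
  have rX3X1 : ⁅X3, X1⁆ = -⁅X1, X3⁆ := (lie_skew _ _).symm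
  have rX3Y1 : ⁅X3, Y1⁆ = -⁅Y1, X3⁆ := (lie_skew _ _).symm
  have rX3X2 : ⁅X3, X2⁆ = -⁅X2, X3⁆ := (lie_skew _ _).symm
  have rX3Y2 : ⁅X3, Y2⁆ = -⁅Y2, X3⁆ := (lie_skew _ _).symm
  have rY3ξ : ⁅Y3, ξ⁆ = -⁅ξ, Y3⁆ := (lie_skew _ _).symm
  have rY3X1 : ⁅Y3, X1⁆ = -⁅X1, Y3⁆ := (lie_skew _ _).symm
  have rY3Y1 : ⁅Y3, Y1⁆ = -⁅Y1, Y3⁆ := (lie_skew _ _).symm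
  have rY3X2 : ⁅Y3, X2⁆ = -⁅X2, Y3⁆ := (lie_skew _ _).symm
  have rY3Y2 : ⁅Y3, Y2⁆ = -⁅Y2, Y3⁆ := (lie_skew _ _).symm
  have rY3X3 : ⁅Y3, X3⁆ = -⁅X3, Y3⁆ := (lie_skew _ _).symm
  have hsum : ∀ u : 𝔤, ∃ c0 c1 c2 c3 c4 c5 c6 : ℝ,
      u = c0 • ξ + c1 • X1 + c2 • Y1 + c3 • X2 + c4 • Y2 + c5 • X3 + c6 • Y3 := by
    intro u
    refine ⟨b.repr u 0, b.repr u 1, b.repr u 2, b.repr u 3, b.repr u 4, b.repr u 5,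
      b.repr u 6, ?_⟩
    have hu := b.sum_repr u
    simp only [hb, Fin.sum_univ_seven] at hu
    exact hu.symm
  have hind : ∀ P : 𝔤 → Prop, (∀ u v, P u → P v → P (u + v)) →
      (∀ (c : ℝ) u, P u → P (c • u)) →
      P ξ → P X1 → P Y1 → P X2 → P Y2 → P X3 → P Y3 → ∀ u, P u := by
    intro P hadd hsmul p0 p1 p2 p3 p4 p5 p6 u
    obtain ⟨c0, c1, c2, c3, c4, c5, c6, rfl⟩ := hsum u
    exact hadd _ _ (hadd _ _ (hadd _ _ (hadd _ _ (hadd _ _ (hadd _ _ (hsmul _ _ p0)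
      (hsmul _ _ p1)) (hsmul _ _ p2)) (hsmul _ _ p3)) (hsmul _ _ p4)) (hsmul _ _ p5))
      (hsmul _ _ p6)
  have hnd : ∀ w : 𝔤, g w ξ = 0 → g w X1 = 0 → g w Y1 = 0 → g w X2 = 0 → g w Y2 = 0 → g w X3 = 0 → g w Y3 = 0 → w = 0 := by
    intro w h0 h1 h2 h3 h4 h5 h6
    obtain ⟨c0, c1, c2, c3, c4, c5, c6, rfl⟩ := hsum w
    simp only [
      map_add, map_neg, map_sub, map_smul, map_zero, LinearMap.add_apply, LinearMap.neg_apply,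
      LinearMap.sub_apply, LinearMap.smul_apply, LinearMap.zero_apply, smul_eq_mul, hg1, hg2,
      hg3, hg4, hg5, hg6, hg7, hg8, hg9, hg10, hg11, hg12, hg13, hg14, hg15, hg16, hg17, hg18,
      hg19, hg20, hg21, hg22, hg23, hg24, hg25, hg26, hg27, hg28, sX1ξ, sY1ξ, sY1X1, sX2ξ,
      sX2X1, sX2Y1, sY2ξ, sY2X1, sY2Y1, sY2X2, sX3ξ, sX3X1, sX3Y1, sX3X2, sX3Y2, sY3ξ, sY3X1,
      sY3Y1, sY3X2, sY3Y2, sY3X3] at h0 h1 h2 h3 h4 h5 h6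
    have e0 : c0 = 0 := by linarith
    have e1 : c1 = 0 := by linarith
    have e2 : c2 = 0 := by linarith
    have e3 : c3 = 0 := by linarith
    have e4 : c4 = 0 := by linarith
    have e5 : c5 = 0 := by linarith
    have e6 : c6 = 0 := by linarith
    simp [e0, e1, e2, e3, e4, e5, e6]
  have hN : ∀ x y v : 𝔤,
      (∀ z ∈ [ξ, X1, Y1, X2, Y2, X3, Y3],
        2 * g v z = g ⁅x, y⁆ z - g ⁅y, z⁆ x + g ⁅z, x⁆ y) → nabla x y = v := by
    intro x y v hv
    rw [← sub_eq_zero]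
    have key : ∀ z ∈ [ξ, X1, Y1, X2, Y2, X3, Y3], g (nabla x y - v) z = 0 := by
      intro z hz
      have e1 := hkoszul x y z
      have e2 := hv z hz
      rw [map_sub, LinearMap.sub_apply]
      linarith
    apply hnd <;> apply key <;> simp
  obtain ⟨nξξ, nξX1, nξY1, nξX2, nξY2, nξX3, nξY3, nX1ξ, nX1X1, nX1Y1, nX1X2, nX1Y2, nX1X3,
  nX1Y3, nY1ξ, nY1X1, nY1Y1, nY1X2, nY1Y2, nY1X3, nY1Y3, nX2ξ, nX2X1, nX2Y1, nX2X2, nX2Y2,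
  nX2X3, nX2Y3, nY2ξ, nY2X1, nY2Y1, nY2X2, nY2Y2, nY2X3, nY2Y3, nX3ξ, nX3X1, nX3Y1, nX3X2,
  nX3Y2, nX3X3, nX3Y3, nY3ξ, nY3X1, nY3Y1, nY3X2, nY3Y2, nY3X3, nY3Y3⟩ :
      nabla ξ ξ = 0 ∧
      nabla ξ X1 = (1 : ℝ) • X2 ∧
      nabla ξ Y1 = (1 : ℝ) • Y2 ∧
      nabla ξ X2 = (1 : ℝ) • X1 ∧
      nabla ξ Y2 = (1 : ℝ) • Y1 ∧
      nabla ξ X3 = 0 ∧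
      nabla ξ Y3 = 0 ∧
      nabla X1 ξ = (-1 : ℝ) • X1 + (-1 : ℝ) • Y1 ∧
      nabla X1 X1 = (1 : ℝ) • ξ + Real.sqrt 2 • X2 ∧
      nabla X1 Y1 = (1 : ℝ) • ξ + Real.sqrt 2 • Y2 ∧
      nabla X1 X2 = Real.sqrt 2 • X1 ∧
      nabla X1 Y2 = Real.sqrt 2 • Y1 ∧
      nabla X1 X3 = 0 ∧
      nabla X1 Y3 = 0 ∧
      nabla Y1 ξ = (1 : ℝ) • Y1 ∧
      nabla Y1 X1 = (-1 : ℝ) • ξ + (-Real.sqrt 2) • X2 ∧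
      nabla Y1 Y1 = (-Real.sqrt 2) • Y2 ∧
      nabla Y1 X2 = (-Real.sqrt 2) • X1 ∧
      nabla Y1 Y2 = (-Real.sqrt 2) • Y1 ∧
      nabla Y1 X3 = 0 ∧
      nabla Y1 Y3 = 0 ∧
      nabla X2 ξ = (-1 : ℝ) • X2 + (-1 : ℝ) • Y2 ∧
      nabla X2 X1 = 0 ∧
      nabla X2 Y1 = 0 ∧
      nabla X2 X2 = (-1 : ℝ) • ξ ∧
      nabla X2 Y2 = (-1 : ℝ) • ξ ∧
      nabla X2 X3 = 0 ∧
      nabla X2 Y3 = 0 ∧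
      nabla Y2 ξ = (1 : ℝ) • Y2 ∧
      nabla Y2 X1 = (-Real.sqrt 2) • X2 ∧
      nabla Y2 Y1 = (-Real.sqrt 2) • Y2 ∧
      nabla Y2 X2 = (1 : ℝ) • ξ + (-Real.sqrt 2) • X1 ∧
      nabla Y2 Y2 = (-Real.sqrt 2) • Y1 ∧
      nabla Y2 X3 = 0 ∧
      nabla Y2 Y3 = 0 ∧
      nabla X3 ξ = (-1 : ℝ) • X3 + (-1 : ℝ) • Y3 ∧
      nabla X3 X1 = 0 ∧
      nabla X3 Y1 = 0 ∧
      nabla X3 X2 = Real.sqrt 2 • X3 ∧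
      nabla X3 Y2 = Real.sqrt 2 • Y3 ∧
      nabla X3 X3 = (-1 : ℝ) • ξ + (-Real.sqrt 2) • X2 ∧
      nabla X3 Y3 = (-1 : ℝ) • ξ + (-Real.sqrt 2) • Y2 ∧
      nabla Y3 ξ = (1 : ℝ) • Y3 ∧
      nabla Y3 X1 = (-Real.sqrt 2) • X3 ∧
      nabla Y3 Y1 = (-Real.sqrt 2) • Y3 ∧
      nabla Y3 X2 = (-Real.sqrt 2) • X3 ∧
      nabla Y3 Y2 = (-Real.sqrt 2) • Y3 ∧
      nabla Y3 X3 = (1 : ℝ) • ξ + (-Real.sqrt 2) • X1 + Real.sqrt 2 • X2 ∧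
      nabla Y3 Y3 = (-Real.sqrt 2) • Y1 + Real.sqrt 2 • Y2 := by
    refine ⟨?_, ?_, ?_, ?_, ?_, ?_, ?_,
      ?_, ?_, ?_, ?_, ?_, ?_, ?_,
      ?_, ?_, ?_, ?_, ?_, ?_, ?_,
      ?_, ?_, ?_, ?_, ?_, ?_, ?_,
      ?_, ?_, ?_, ?_, ?_, ?_, ?_,
      ?_, ?_, ?_, ?_, ?_, ?_, ?_,
      ?_, ?_, ?_, ?_, ?_, ?_, ?_⟩ <;> apply hN <;>
    simp only [List.forall_mem_cons, List.not_mem_nil, false_imp_iff, implies_true, and_true,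
      lie_self, rX1ξ, rY1ξ, rY1X1, rX2ξ, rX2X1, rX2Y1, rY2ξ, rY2X1, rY2Y1, rY2X2, rX3ξ, rX3X1,
      rX3Y1, rX3X2, rX3Y2, rY3ξ, rY3X1, rY3Y1, rY3X2, rY3Y2, rY3X3, br1, br2, br3, br4, br5,
      br6, br7, br8, br9, br10, br11, br12, br13, br14, br15, br16, br17, br18, br19, br20,
      br21, map_add, map_neg, map_sub, map_smul, map_zero, LinearMap.add_apply,
      LinearMap.neg_apply, LinearMap.sub_apply, LinearMap.smul_apply, LinearMap.zero_apply,
      smul_eq_mul, hg1, hg2, hg3, hg4, hg5, hg6, hg7, hg8, hg9, hg10, hg11, hg12, hg13, hg14,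
      hg15, hg16, hg17, hg18, hg19, hg20, hg21, hg22, hg23, hg24, hg25, hg26, hg27, hg28, sX1ξ,
      sY1ξ, sY1X1, sX2ξ, sX2X1, sX2Y1, sY2ξ, sY2X1, sY2Y1, sY2X2, sX3ξ, sX3X1, sX3Y1, sX3X2,
      sX3Y2, sY3ξ, sY3X1, sY3Y1, sY3X2, sY3Y2, sY3X3] <;>
    norm_num <;> ring
  have hX1 : h X1 = Y1 := by
    simp only [hdef, hφξ, hφX1, hφY1, hφX2, hφY2, hφX3, hφY3, map_add,
      map_neg, map_sub, lie_neg, lie_zero, map_zero, lie_self, br1, br2, br3, br4, br5, br6]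
    module
  have hX2 : h X2 = Y2 := by
    simp only [hdef, hφξ, hφX1, hφY1, hφX2, hφY2, hφX3, hφY3, map_add,
      map_neg, map_sub, lie_neg, lie_zero, map_zero, lie_self, br1, br2, br3, br4, br5, br6]
    module
  have hX3 : h X3 = Y3 := by
    simp only [hdef, hφξ, hφX1, hφY1, hφX2, hφY2, hφX3, hφY3, map_add,
      map_neg, map_sub, lie_neg, lie_zero, map_zero, lie_self, br1, br2, br3, br4, br5, br6]
    module
  have hY1 : h Y1 = 0 := by
    simp only [hdef, hφξ, hφX1, hφY1, hφX2, hφY2, hφX3, hφY3, map_add,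
      map_neg, map_sub, lie_neg, lie_zero, map_zero, lie_self, br1, br2, br3, br4, br5, br6]
    module
  have hY2 : h Y2 = 0 := by
    simp only [hdef, hφξ, hφX1, hφY1, hφX2, hφY2, hφX3, hφY3, map_add,
      map_neg, map_sub, lie_neg, lie_zero, map_zero, lie_self, br1, br2, br3, br4, br5, br6]
    module
  have hY3 : h Y3 = 0 := by
    simp only [hdef, hφξ, hφX1, hφY1, hφX2, hφY2, hφX3, hφY3, map_add,
      map_neg, map_sub, lie_neg, lie_zero, map_zero, lie_self, br1, br2, br3, br4, br5, br6]
    module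
  have hξ : h ξ = 0 := by
    simp only [hdef, hφξ, hφX1, hφY1, hφX2, hφY2, hφX3, hφY3, map_add,
      map_neg, map_sub, lie_neg, lie_zero, map_zero, lie_self, br1, br2, br3, br4, br5, br6]
    module
  refine ⟨hX1, hX2, hX3, hY1, hY2, hY3, hξ, ?_, ?_, ?_⟩
  · ext u
    obtain ⟨c0, c1, c2, c3, c4, c5, c6, rfl⟩ := hsum u
    simp [hX1, hX2, hX3, hY1, hY2, hY3, hξ]
  · have hli : LinearIndependent ℝ ![Y1, Y2, Y3] := by
      have := b.linearIndependent.comp ![2, 4, 6] (by decide)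
      convert this using 1
      funext i
      fin_cases i <;> simp [hb]
    have hrange : LinearMap.range h = Submodule.span ℝ (Set.range ![Y1, Y2, Y3]) := by
      apply le_antisymm
      · rintro _ ⟨u, rfl⟩
        obtain ⟨c0, c1, c2, c3, c4, c5, c6, rfl⟩ := hsum u
        simp only [map_add, map_smul, hX1, hX2, hX3, hY1, hY2, hY3, hξ, smul_zero, add_zero,
          zero_add]
        refine add_mem (add_mem ?_ ?_) ?_ <;> apply Submodule.smul_mem <;>
          apply Submodule.subset_span <;> simp
      · rw [Submodule.span_le]
        rintro _ ⟨i, rfl⟩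
        fin_cases i
        · exact ⟨X1, hX1⟩
        · exact ⟨X2, hX2⟩
        · exact ⟨X3, hX3⟩
    rw [hrange, finrank_span_eq_card hli]
    simp
  · intro x y
    rw [hR, hη, hη]
    revert y
    refine hind (fun x => ∀ y, nabla x (nabla y ξ) - nabla y (nabla x ξ) - nabla ⁅x, y⁆ ξ =
      -(g y ξ • x - g x ξ • y)) ?_ ?_ ?_ ?_ ?_ ?_ ?_ ?_ ?_ x
    · intro u v hu hv y
      simp only [map_add, LinearMap.add_apply, add_lie]
      linear_combination (norm := module) hu y + hv y
    · intro c u hu y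
      simp only [map_smul, LinearMap.smul_apply, smul_lie, smul_eq_mul]
      linear_combination (norm := module) c • hu y
    all_goals
      refine hind _ ?_ ?_ ?_ ?_ ?_ ?_ ?_ ?_ ?_
      · intro u v hu hv
        simp only [map_add, LinearMap.add_apply, lie_add]
        linear_combination (norm := module) hu + hv
      · intro c u hu
        simp only [map_smul, LinearMap.smul_apply, lie_smul, smul_eq_mul]
        linear_combination (norm := module) c • hu
      all_goals
        simp only [
          nξξ, nξX1, nξY1, nξX2, nξY2, nξX3, nξY3, nX1ξ, nX1X1, nX1Y1, nX1X2, nX1Y2, nX1X3,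
          nX1Y3, nY1ξ, nY1X1, nY1Y1, nY1X2, nY1Y2, nY1X3, nY1Y3, nX2ξ, nX2X1, nX2Y1, nX2X2,
          nX2Y2, nX2X3, nX2Y3, nY2ξ, nY2X1, nY2Y1, nY2X2, nY2Y2, nY2X3, nY2Y3, nX3ξ, nX3X1,
          nX3Y1, nX3X2, nX3Y2, nX3X3, nX3Y3, nY3ξ, nY3X1, nY3Y1, nY3X2, nY3Y2, nY3X3, nY3Y3,
          lie_self, rX1ξ, rY1ξ, rY1X1, rX2ξ, rX2X1, rX2Y1, rY2ξ, rY2X1, rY2Y1, rY2X2, rX3ξ,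
          rX3X1, rX3Y1, rX3X2, rX3Y2, rY3ξ, rY3X1, rY3Y1, rY3X2, rY3Y2, rY3X3, br1, br2, br3,
          br4, br5, br6, br7, br8, br9, br10, br11, br12, br13, br14, br15, br16, br17, br18,
          br19, br20, br21, map_add, map_neg, map_sub, map_smul, map_zero, LinearMap.add_apply,
          LinearMap.neg_apply, LinearMap.sub_apply, LinearMap.smul_apply, LinearMap.zero_apply,
          smul_eq_mul, hg1, hg2, hg3, hg4, hg5, hg6, hg7, hg8, hg9, hg10, hg11, hg12, hg13,
          hg14, hg15, hg16, hg17, hg18, hg19, hg20, hg21, hg22, hg23, hg24, hg25, hg26, hg27,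
          hg28, sX1ξ, sY1ξ, sY1X1, sX2ξ, sX2X1, sX2Y1, sY2ξ, sY2X1, sY2Y1, sY2X2, sX3ξ, sX3X1,
          sX3Y1, sX3X2, sX3Y2, sY3ξ, sY3X1, sY3Y1, sY3X2, sY3Y2, sY3X3]
        module
end
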